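/- arXiv:math/0304387 — 5 statements merged into one kernel-verified Lean document; each statement's English description precedes it below -/
import Mathlib

section
/- Let P_1,...,P_n be mutually orthogonal projections on a Hilbert space H, all of the same finite nonzero rank k, let r_1,...,r_n ≥ 0, and suppose r = ∑ r_i is an integer with r ≥ n. Then A = ∑ r_i P_i can be written as a sum of r self-adjoint projections each of rank k. -/
open ContinuousLinearMap in
/-- A self-adjoint idempotent of finite nonzero rank `k` factors through an isometry
from `𝕜ᵏ`. -/
lemma exists_isometry_comp_adjoint_eq
    {𝕜 H : Type*} [RCLike 𝕜] [NormedAddCommGroup H] [InnerProductSpace 𝕜 H] [CompleteSpace H]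
    {k : ℕ} (hk : 0 < k) {P : H →L[𝕜] H} (hsa : IsSelfAdjoint P) (hid : P ∘L P = P)
    (hrank : Module.finrank 𝕜 (LinearMap.range (P : H →ₗ[𝕜] H)) = k) :
    ∃ U : EuclideanSpace 𝕜 (Fin k) →L[𝕜] H,
      adjoint U ∘L U = ContinuousLinearMap.id 𝕜 _ ∧ U ∘L adjoint U = P ∧ P ∘L U = U := by
  have : FiniteDimensional 𝕜 (LinearMap.range (P : H →ₗ[𝕜] H)) :=
    FiniteDimensional.of_finrank_pos (hrank ▸ hk)
  let b := (stdOrthonormalBasis 𝕜 (LinearMap.range (P : H →ₗ[𝕜] H))).reindex (finCongr hrank)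
  let V : EuclideanSpace 𝕜 (Fin k) →ₗᵢ[𝕜] H :=
    (LinearMap.range (P : H →ₗ[𝕜] H)).subtypeₗᵢ.comp b.repr.symm.toLinearIsometry
  let U : EuclideanSpace 𝕜 (Fin k) →L[𝕜] H := V.toContinuousLinearMap
  have hUU : adjoint U ∘L U = ContinuousLinearMap.id 𝕜 _ := by
    ext1 x
    refine ext_inner_right 𝕜 fun y => ?_
    simp only [comp_apply, adjoint_inner_left, id_apply]
    exact V.inner_map_map x y
  have hPU : P ∘L U = U := by
    ext1 x
    obtain ⟨z, hz⟩ := (b.repr.symm x).2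
    have hU : U x = P z := hz.symm
    rw [comp_apply, hU, ← comp_apply, hid]
  have hUP : adjoint U ∘L P = adjoint U := by
    have h := congrArg adjoint hPU
    rwa [adjoint_comp, hsa.adjoint_eq] at h
  refine ⟨U, hUU, ?_, hPU⟩
  ext1 x
  have hy : P x = U (b.repr ⟨P x, x, rfl⟩) := by
    simp [U, V]
  calc (U ∘L adjoint U) x = U ((adjoint U ∘L P) x) := by rw [hUP]; rfl
    _ = U ((adjoint U ∘L U) (b.repr ⟨P x, x, rfl⟩)) := by
      rw [comp_apply, comp_apply, ← hy]
    _ = P x := by rw [hUU, id_apply, ← hy]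

/-- A planar rotation of two vectors, one shorter and one longer than `1`, makes the first of
them a unit vector. -/
lemma exists_rotation_sum_sq_eq_one {κ : Type*} [Fintype κ] (x y : κ → ℝ)
    (hx : ∑ i, x i ^ 2 < 1) (hy : 1 < ∑ i, y i ^ 2) :
    ∃ c s : ℝ, c ^ 2 + s ^ 2 = 1 ∧ ∑ i, (c * x i + s * y i) ^ 2 = 1 := by
  have hcont : ContinuousOn
      (fun t : ℝ => ∑ i, (Real.cos t * x i + Real.sin t * y i) ^ 2)
      (Set.Icc 0 (Real.pi / 2)) := by fun_prop
  obtain ⟨t, -, ht⟩ := intermediate_value_Icc (by positivity) hcont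
    (show (1 : ℝ) ∈ _ by constructor <;> simp <;> linarith)
  exact ⟨Real.cos t, Real.sin t, Real.cos_sq_add_sin_sq t, ht⟩

/-- A finite family of real vectors whose squared lengths average to `1` has the same frame
operator as some family of unit vectors with the same index set. -/
lemma exists_unit_vectors_same_frame {ι κ : Type*} [Fintype ι] [Fintype κ]
    (v : ι → κ → ℝ) (hv : ∑ l, ∑ i, v l i ^ 2 = Fintype.card ι) :
    ∃ w : ι → κ → ℝ, (∀ l, ∑ i, w l i ^ 2 = 1) ∧
      ∀ i j, ∑ l, w l i * w l j = ∑ l, v l i * v l j := by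
  classical
  induction hm : (Finset.univ.filter fun l => ∑ i, v l i ^ 2 ≠ 1).card using
    Nat.strong_induction_on generalizing v with
  | _ m ih =>
  by_cases hall : ∀ l, ∑ i, v l i ^ 2 = 1
  · exact ⟨v, hall, fun _ _ => rfl⟩
  have hsum : ∑ l, ∑ i, v l i ^ 2 = ∑ _l : ι, (1 : ℝ) := by simp [hv]
  obtain ⟨a, ha⟩ : ∃ a, ∑ i, v a i ^ 2 < 1 := by
    by_contra! h
    exact hall fun l =>
      ((Finset.sum_eq_sum_iff_of_le fun l _ => h l).1 hsum.symm l (Finset.mem_univ l)).symm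
  obtain ⟨b, hb⟩ : ∃ b, 1 < ∑ i, v b i ^ 2 := by
    by_contra! h
    exact hall fun l =>
      (Finset.sum_eq_sum_iff_of_le fun l _ => h l).1 hsum l (Finset.mem_univ l)
  have hab : a ≠ b := by rintro rfl; linarith
  obtain ⟨c, s, hcs, hone⟩ := exists_rotation_sum_sq_eq_one (v a) (v b) ha hb
  let u : ι → κ → ℝ := Function.update
    (Function.update v a fun i => c * v a i + s * v b i) b fun i => -s * v a i + c * v b i
  have hua : u a = fun i => c * v a i + s * v b i := by simp [u, hab]
  have hub : u b = fun i => -s * v a i + c * v b i := by simp [u]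
  have hu : ∀ l, l ≠ a → l ≠ b → u l = v l := fun l h h' => by simp [u, h, h']
  have hframe : ∀ i j, ∑ l, u l i * u l j = ∑ l, v l i * v l j := by
    intro i j
    rw [← sub_eq_zero, ← Finset.sum_sub_distrib, Fintype.sum_eq_add a b hab, hua, hub]
    · linear_combination (v a i * v a j + v b i * v b j) * hcs
    · rintro l ⟨h, h'⟩
      rw [hu l h h', sub_self]
  have hnorm : ∑ l, ∑ i, u l i ^ 2 = Fintype.card ι := by
    rw [← hv, Finset.sum_comm, Finset.sum_comm (f := fun l i => v l i ^ 2)]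
    exact Finset.sum_congr rfl fun i _ => by simpa only [sq] using hframe i i
  have hlt : (Finset.univ.filter fun l => ∑ i, u l i ^ 2 ≠ 1).card < m := by
    rw [← hm]
    refine Finset.card_lt_card ((Finset.ssubset_iff_of_subset fun l hl => ?_).2
      ⟨a, by simp [ha.ne], by simp [hua, hone]⟩)
    simp only [Finset.mem_filter, Finset.mem_univ, true_and] at hl ⊢
    by_cases hla : l = a
    · subst hla
      exact absurd (by rw [hua]; exact hone) hl
    by_cases hlb : l = b
    · subst hlb
      exact hb.ne'
    rwa [hu l hla hlb] at hl
  obtain ⟨w, hw, hwu⟩ := ih _ hlt u hnorm rfl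
  exact ⟨w, hw, fun i j => (hwu i j).trans (hframe i j)⟩

/-- A diagonal real matrix with nonnegative entries summing to an integer `R`, at least its size,
is a sum of `R` projections onto real lines. -/
lemma exists_unit_vectors_frame_eq_diagonal {n R : ℕ} (r : Fin n → ℝ) (hr : ∀ i, 0 ≤ r i)
    (hR : (R : ℝ) = ∑ i, r i) (hnR : n ≤ R) :
    ∃ w : Fin R → Fin n → ℝ, (∀ l, ∑ i, w l i ^ 2 = 1) ∧
      ∀ i j, ∑ l, w l i * w l j = if i = j then r i else 0 := by
  let v : Fin R → Fin n → ℝ := fun l i => if l = Fin.castLE hnR i then √(r i) else 0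
  have hvv : ∀ i j, ∑ l, v l i * v l j = if i = j then r i else 0 := by
    intro i j
    by_cases hij : i = j
    · subst hij
      simp [v, Real.mul_self_sqrt (hr i)]
    · simp [v, hij, Ne.symm hij]
  obtain ⟨w, hw, hwv⟩ := exists_unit_vectors_same_frame v (by
    rw [Finset.sum_comm, Fintype.card_fin, hR]
    exact Finset.sum_congr rfl fun i _ => by simpa [sq] using hvv i i)
  exact ⟨w, hw, fun i j => (hwv i j).trans (hvv i j)⟩

open ContinuousLinearMap in
/-- If `W` is an isometry, then `W W†` is a self-adjoint projection whose rank is the dimension of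
the domain of `W`. -/
lemma isometry_comp_adjoint_isProjection
    {𝕜 E H : Type*} [RCLike 𝕜] [NormedAddCommGroup E] [InnerProductSpace 𝕜 E] [CompleteSpace E]
    [NormedAddCommGroup H] [InnerProductSpace 𝕜 H] [CompleteSpace H]
    {W : E →L[𝕜] H} (hW : adjoint W ∘L W = ContinuousLinearMap.id 𝕜 E) :
    (IsSelfAdjoint (W ∘L adjoint W) ∧
      (W ∘L adjoint W) ∘L (W ∘L adjoint W) = W ∘L adjoint W) ∧
    Module.finrank 𝕜 (LinearMap.range ((W ∘L adjoint W : H →L[𝕜] H) : H →ₗ[𝕜] H)) =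
      Module.finrank 𝕜 E := by
  have happ : ∀ x, adjoint W (W x) = x := fun x => congrArg (fun f => f x) hW
  refine ⟨⟨?_, ?_⟩, ?_⟩
  · rw [isSelfAdjoint_iff', adjoint_comp, adjoint_adjoint]
  · ext x
    simp [happ]
  · have hrange : LinearMap.range ((W ∘L adjoint W : H →L[𝕜] H) : H →ₗ[𝕜] H) =
        LinearMap.range (W : E →ₗ[𝕜] H) := by
      exact LinearMap.range_comp_of_range_eq_top (f := (adjoint W : H →ₗ[𝕜] E)) (W : E →ₗ[𝕜] H)
        (LinearMap.range_eq_top.2 fun x => ⟨W x, happ x⟩)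
    rw [hrange]
    exact LinearMap.finrank_range_of_inj (Function.LeftInverse.injective happ)


/-- If `P₁,…,Pₙ` are mutually orthogonal projections all of the same
finite nonzero rank `k`, `rᵢ ≥ 0`, and `r = ∑ rᵢ` is an integer with `r ≥ n`, then
`A = ∑ rᵢ Pᵢ` is a sum of `r` self-adjoint projections of rank `k`. -/
theorem sum_scalar_orthogonal_projections_eq_sum_rank_k_projections
    {𝕜 H : Type*} [RCLike 𝕜] [NormedAddCommGroup H] [InnerProductSpace 𝕜 H]
    [CompleteSpace H] [TopologicalSpace.SeparableSpace H]
    (n k : ℕ) (hk : 0 < k)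
    (P : Fin n → (H →L[𝕜] H))
    (hproj : ∀ i, IsSelfAdjoint (P i) ∧ (P i) ∘L (P i) = P i)
    (horth : ∀ i j, i ≠ j → (P i) ∘L (P j) = 0)
    (hrank : ∀ i, Module.finrank 𝕜 (LinearMap.range ((P i) : H →ₗ[𝕜] H)) = k)
    (r : Fin n → ℝ) (hr : ∀ i, 0 ≤ r i)
    (R : ℕ) (hR : (R : ℝ) = ∑ i, r i) (hnR : n ≤ R) :
    ∃ Q : Fin R → (H →L[𝕜] H),
      (∀ l, IsSelfAdjoint (Q l) ∧ (Q l) ∘L (Q l) = Q l) ∧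
      (∀ l, Module.finrank 𝕜 (LinearMap.range ((Q l) : H →ₗ[𝕜] H)) = k) ∧
      (∑ i, ((r i : 𝕜) • P i)) = ∑ l, Q l := by
  choose U hUU hUP hPU using fun i =>
    exists_isometry_comp_adjoint_eq hk (hproj i).1 (hproj i).2 (hrank i)
  have hU : ∀ i j, ContinuousLinearMap.adjoint (U i) ∘L U j =
      if i = j then ContinuousLinearMap.id 𝕜 _ else 0 := by
    intro i j
    split_ifs with hij
    · subst hij; exact hUU i
    · have h : ContinuousLinearMap.adjoint (U i) ∘L P i = ContinuousLinearMap.adjoint (U i) := by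
        have h := congrArg ContinuousLinearMap.adjoint (hPU i)
        rwa [ContinuousLinearMap.adjoint_comp, (hproj i).1.adjoint_eq] at h
      rw [← h, ← hPU j, ContinuousLinearMap.comp_assoc, ← ContinuousLinearMap.comp_assoc (P i),
        horth i j hij, ContinuousLinearMap.zero_comp, ContinuousLinearMap.comp_zero]
  obtain ⟨w, hw, hwr⟩ := exists_unit_vectors_frame_eq_diagonal r hr hR hnR
  let W : Fin R → (EuclideanSpace 𝕜 (Fin k) →L[𝕜] H) := fun l => ∑ i, (w l i : 𝕜) • U i
  have hadj : ∀ l, ContinuousLinearMap.adjoint (W l) =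
      ∑ i, (w l i : 𝕜) • ContinuousLinearMap.adjoint (U i) := fun l => by
    simp [W, map_sum, map_smulₛₗ]
  have hW : ∀ l, ContinuousLinearMap.adjoint (W l) ∘L W l = ContinuousLinearMap.id 𝕜 _ := by
    intro l
    have h : ∑ i, (w l i : 𝕜) * (w l i : 𝕜) = 1 := by
      rw [← RCLike.ofReal_one, ← hw l]
      push_cast
      simp only [sq]
    rw [hadj]
    simp only [W, ContinuousLinearMap.finsetSum_comp, ContinuousLinearMap.comp_finsetSum,
      ContinuousLinearMap.smul_comp, ContinuousLinearMap.comp_smul, hU, smul_ite, smul_zero,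
      Finset.sum_ite_eq', Finset.mem_univ, if_true, smul_smul]
    rw [← Finset.sum_smul, h, one_smul]
  have hQ := fun l => isometry_comp_adjoint_isProjection (hW l)
  refine ⟨fun l => W l ∘L ContinuousLinearMap.adjoint (W l), fun l => (hQ l).1,
    fun l => by simpa using (hQ l).2, ?_⟩
  have hcoef : ∀ i j, ∑ l, (w l i : 𝕜) * (w l j : 𝕜) = if i = j then (r i : 𝕜) else 0 := by
    intro i j
    have h := congrArg (RCLike.ofReal (K := 𝕜)) (hwr i j)
    push_cast at h
    rw [h]
    split_ifs <;> simp
  symm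
  calc ∑ l, W l ∘L ContinuousLinearMap.adjoint (W l)
      = ∑ l, ∑ i, ∑ j, ((w l i : 𝕜) * (w l j : 𝕜)) •
          (U i ∘L ContinuousLinearMap.adjoint (U j)) := by
        refine Finset.sum_congr rfl fun l _ => ?_
        rw [hadj]
        simp only [W, ContinuousLinearMap.finsetSum_comp, ContinuousLinearMap.comp_finsetSum,
          ContinuousLinearMap.smul_comp, ContinuousLinearMap.comp_smul, smul_smul, Finset.smul_sum]
        exact Finset.sum_comm.trans (by simp only [mul_comm])
    _ = ∑ i, ∑ j, (∑ l, (w l i : 𝕜) * (w l j : 𝕜)) •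
          (U i ∘L ContinuousLinearMap.adjoint (U j)) := by
        rw [Finset.sum_comm]
        refine Finset.sum_congr rfl fun i _ => ?_
        rw [Finset.sum_comm]
        simp only [Finset.sum_smul]
    _ = ∑ i, (r i : 𝕜) • P i := by
        simp only [hcoef, ite_smul, zero_smul, Finset.sum_ite_eq, Finset.mem_univ, if_true, hUP]
end

section
/- Let A be a positive operator on an infinite-dimensional separable Hilbert space with finite spectrum contained in the rationals, such that every nonzero spectral projection of A is infinite-dimensional, and ‖A‖ > 1. Then A is a finite sum of self-adjoint projections. -/
open ContinuousLinearMap in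
/-- A family of operators with scalar real Gram matrix of trace equal to the number of operators can
be rotated into a family of isometries without changing the sum of the `W i ∘L (W i)†`. -/
theorem exists_isometries_of_sum_gram_eq_card
    {𝕜 K H ι : Type*} [RCLike 𝕜] [NormedAddCommGroup K] [InnerProductSpace 𝕜 K] [CompleteSpace K]
    [NormedAddCommGroup H] [InnerProductSpace 𝕜 H] [CompleteSpace H] [Fintype ι]
    (W : ι → K →L[𝕜] H) (G : ι → ι → ℝ)
    (hG : ∀ i j, adjoint (W i) ∘L W j = (G i j : 𝕜) • ContinuousLinearMap.id 𝕜 K)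
    (hsum : ∑ i, G i i = Fintype.card ι) :
    ∃ V : ι → K →L[𝕜] H, (∀ i, adjoint (V i) ∘L V i = ContinuousLinearMap.id 𝕜 K) ∧
      ∑ i, V i ∘L adjoint (V i) = ∑ i, W i ∘L adjoint (W i) := by
  classical
  induction hn : (Finset.univ.filter fun i => G i i ≠ 1).card using Nat.strong_induction_on
    generalizing W G with
  | _ n ih =>
  by_cases hall : ∀ i, G i i = 1
  · exact ⟨W, fun i => by simp [hG, hall], rfl⟩
  push Not at hall
  obtain ⟨i₀, hi₀⟩ := hall
  have hzero : ∑ i, (G i i - 1) = 0 := by simp [hsum]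
  have hzero' : ∑ i, (1 - G i i) = 0 := by simp [hsum]
  obtain ⟨j, -, hj⟩ := Finset.exists_pos_of_sum_zero_of_exists_nonzero _ hzero
    ⟨i₀, Finset.mem_univ _, sub_ne_zero.mpr hi₀⟩
  obtain ⟨i, -, hi⟩ := Finset.exists_pos_of_sum_zero_of_exists_nonzero _ hzero'
    ⟨i₀, Finset.mem_univ _, sub_ne_zero.mpr hi₀.symm⟩
  have hij : i ≠ j := by rintro rfl; linarith
  obtain ⟨c, s, hcs, hone⟩ : ∃ c s : ℝ, c ^ 2 + s ^ 2 = 1 ∧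
      c * c * G i i + c * s * G i j + s * c * G j i + s * s * G j j = 1 := by
    let f : ℝ → ℝ := fun t => Real.cos t * Real.cos t * G i i + Real.cos t * Real.sin t * G i j +
      Real.sin t * Real.cos t * G j i + Real.sin t * Real.sin t * G j j
    have hf : Continuous f := by fun_prop
    obtain ⟨t, -, ht⟩ := intermediate_value_Icc (by positivity : (0 : ℝ) ≤ Real.pi / 2)
      hf.continuousOn (show (1 : ℝ) ∈ Set.Icc (f 0) (f (Real.pi / 2)) by
        simp only [f, Real.cos_zero, Real.sin_zero, Real.cos_pi_div_two, Real.sin_pi_div_two]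
        constructor <;> linarith)
    exact ⟨Real.cos t, Real.sin t, Real.cos_sq_add_sin_sq t, ht⟩
  let σ := Equiv.swap i j
  let α : ι → ℝ := fun k => if k = i ∨ k = j then c else 1
  let β : ι → ℝ := fun k => if k = i then s else if k = j then -s else 0
  let W' : ι → K →L[𝕜] H := fun k => (α k : 𝕜) • W k + (β k : 𝕜) • W (σ k)
  let G' : ι → ι → ℝ := fun k l => α k * α l * G k l + α k * β l * G k (σ l) +
    β k * α l * G (σ k) l + β k * β l * G (σ k) (σ l)
  have hσi : σ i = j := Equiv.swap_apply_left _ _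
  have hσj : σ j = i := Equiv.swap_apply_right _ _
  have hαi : α i = c := by simp [α]
  have hαj : α j = c := by simp [α]
  have hβi : β i = s := by simp [β]
  have hβj : β j = -s := by simp [β, hij.symm]
  have hα : ∀ k, k ≠ i ∧ k ≠ j → α k = 1 := fun k hk => by simp [α, hk.1, hk.2]
  have hβ : ∀ k, k ≠ i ∧ k ≠ j → β k = 0 := fun k hk => by simp [β, hk.1, hk.2]
  have hG'k : ∀ k, k ≠ i ∧ k ≠ j → G' k k = G k k := fun k hk => by simp [G', hα k hk, hβ k hk]
  have hG'i : G' i i = 1 := by simpa only [G', hσi, hαi, hβi] using hone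
  have hG' : ∀ k l, adjoint (W' k) ∘L W' l = (G' k l : 𝕜) • ContinuousLinearMap.id 𝕜 K := by
    intro k l
    simp only [W', map_add, map_smulₛₗ, RCLike.conj_ofReal, add_comp, comp_add, smul_comp,
      comp_smul, hG, G']
    push_cast
    module
  have htrace : ∑ k, G' k k = Fintype.card ι := by
    rw [← hsum, ← sub_eq_zero, ← Finset.sum_sub_distrib,
      Fintype.sum_eq_add i j hij fun k hk => by rw [hG'k k hk, sub_self]]
    simp only [G', hσi, hσj, hαi, hαj, hβi, hβj]
    linear_combination (G i i + G j j) * hcs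
  have hWW : ∑ k, W' k ∘L adjoint (W' k) = ∑ k, W k ∘L adjoint (W k) := by
    have hcs' : (c : 𝕜) ^ 2 + (s : 𝕜) ^ 2 = 1 := mod_cast congrArg (RCLike.ofReal (K := 𝕜)) hcs
    rw [← sub_eq_zero, ← Finset.sum_sub_distrib,
      Fintype.sum_eq_add i j hij fun k hk => by simp [W', hα k hk, hβ k hk]]
    simp only [W', hσi, hσj, hαi, hαj, hβi, hβj, map_add, map_smulₛₗ, RCLike.conj_ofReal, add_comp,
      comp_add, smul_comp, comp_smul]
    push_cast
    linear_combination (norm := module) hcs' • (W i ∘L adjoint (W i) + W j ∘L adjoint (W j))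
  have hlt : (Finset.univ.filter fun k => G' k k ≠ 1).card < n := by
    rw [← hn]
    refine Finset.card_lt_card (Finset.ssubset_iff_of_subset ?_ |>.mpr ⟨i, ?_, ?_⟩)
    · intro k hk
      simp only [Finset.mem_filter_univ] at hk ⊢
      by_cases hki : k = i
      · subst hki; linarith
      by_cases hkj : k = j
      · subst hkj; linarith
      rwa [hG'k k ⟨hki, hkj⟩] at hk
    · simp only [Finset.mem_filter_univ]; linarith
    · simp [hG'i]
  obtain ⟨V, hV, hVW⟩ := ih _ hlt W' G' hG' htrace rfl
  exact ⟨V, hV, hVW.trans hWW⟩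

open ContinuousLinearMap in
/-- A nonnegative combination of the range projections of isometries with mutually orthogonal ranges
is a finite sum of projections as soon as the sum of its weights is an integer not less than their
number. -/
theorem exists_projections_of_weighted_isometries
    {𝕜 K H κ : Type*} [RCLike 𝕜] [NormedAddCommGroup K] [InnerProductSpace 𝕜 K] [CompleteSpace K]
    [NormedAddCommGroup H] [InnerProductSpace 𝕜 H] [CompleteSpace H] [Fintype κ] [DecidableEq κ]
    (V : κ → K →L[𝕜] H)
    (hV : ∀ a b, adjoint (V a) ∘L V b = if a = b then ContinuousLinearMap.id 𝕜 K else 0)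
    (w : κ → ℝ) (hw : ∀ a, 0 ≤ w a) (T : ℕ) (hT : ∑ a, w a = T) (hcard : Fintype.card κ ≤ T) :
    ∃ (N : ℕ) (Q : Fin N → (H →L[𝕜] H)),
      (∀ l, IsSelfAdjoint (Q l) ∧ (Q l) ∘L (Q l) = Q l) ∧
      ∑ a, (w a : 𝕜) • (V a ∘L adjoint (V a)) = ∑ l, Q l := by
  have hsq : ∀ a, (Real.sqrt (w a) : 𝕜) * (Real.sqrt (w a) : 𝕜) = (w a : 𝕜) := by
    intro a
    rw [← RCLike.ofReal_mul, Real.mul_self_sqrt (hw a)]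
  let W : κ ⊕ Fin (T - Fintype.card κ) → K →L[𝕜] H :=
    Sum.elim (fun a => (Real.sqrt (w a) : 𝕜) • V a) 0
  let G : κ ⊕ Fin (T - Fintype.card κ) → κ ⊕ Fin (T - Fintype.card κ) → ℝ :=
    Sum.elim (fun a => Sum.elim (fun b => if a = b then w a else 0) 0) 0
  have hG : ∀ x y, adjoint (W x) ∘L W y = (G x y : 𝕜) • ContinuousLinearMap.id 𝕜 K := by
    rintro (a | a) (b | b)
    · simp only [W, G, Sum.elim_inl, map_smulₛₗ, RCLike.conj_ofReal, smul_comp, comp_smul,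
        smul_smul, hV]
      split_ifs with hab
      · subst hab
        rw [hsq]
      · simp
    all_goals simp [W, G]
  have htrace : ∑ x, G x x = Fintype.card (κ ⊕ Fin (T - Fintype.card κ)) := by
    simp [G, hT, hcard]
  obtain ⟨U, hU, hUW⟩ := exists_isometries_of_sum_gram_eq_card W G hG htrace
  let e := Fintype.equivFin (κ ⊕ Fin (T - Fintype.card κ))
  refine ⟨_, fun l => U (e.symm l) ∘L adjoint (U (e.symm l)), fun l => ⟨?_, ?_⟩, ?_⟩
  · rw [isSelfAdjoint_iff', adjoint_comp, adjoint_adjoint]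
  · rw [comp_assoc, ← comp_assoc _ _ (adjoint _), hU, id_comp]
  · rw [e.symm.sum_comp (fun x => U x ∘L adjoint (U x)), hUW, Fintype.sum_sum_type]
    simp only [W, Sum.elim_inl, Sum.elim_inr, map_smulₛₗ, RCLike.conj_ofReal, smul_comp, comp_smul,
      smul_smul, hsq]
    simp

/-- An orthonormal family in a separable space is countable. -/
theorem Orthonormal.countable_of_separableSpace
    {𝕜 E ι : Type*} [RCLike 𝕜] [NormedAddCommGroup E] [InnerProductSpace 𝕜 E]
    [TopologicalSpace.SeparableSpace E] {v : ι → E} (hv : Orthonormal 𝕜 v) : Countable ι := by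
  refine Pairwise.countable_of_isOpen_disjoint (s := fun i => Metric.ball (v i) (1 / 2)) ?_
    (fun i => Metric.isOpen_ball) (fun i => ⟨v i, Metric.mem_ball_self (by norm_num)⟩)
  intro i j hij
  refine Metric.ball_disjoint_ball ?_
  have h : ‖v i - v j‖ ^ 2 = 2 := by
    rw [@norm_sub_sq 𝕜, hv.1 i, hv.1 j, hv.2 hij]; norm_num
  rw [dist_eq_norm]
  nlinarith [norm_nonneg (v i - v j)]

/-- A separable infinite-dimensional Hilbert space has a Hilbert basis indexed by any countably
infinite type. -/
theorem nonempty_hilbertBasis_of_infinite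
    (𝕜 E κ : Type*) [RCLike 𝕜] [NormedAddCommGroup E] [InnerProductSpace 𝕜 E] [CompleteSpace E]
    [TopologicalSpace.SeparableSpace E] (hE : ¬ FiniteDimensional 𝕜 E)
    [Countable κ] [Infinite κ] : Nonempty (HilbertBasis κ 𝕜 E) := by
  obtain ⟨w, b, -⟩ := exists_hilbertBasis 𝕜 E
  have : Countable w := b.orthonormal.countable_of_separableSpace
  have : Infinite w := by
    by_contra h
    rw [not_infinite_iff_finite] at h
    have := Fintype.ofFinite w
    exact hE b.toOrthonormalBasis.toBasis.finiteDimensional_of_finite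
  obtain ⟨e⟩ : Nonempty (κ ≃ w) := nonempty_equiv_of_countable
  refine ⟨HilbertBasis.mk (b.orthonormal.comp e e.injective) ?_⟩
  rw [e.surjective.range_comp, b.dense_span]

open ContinuousLinearMap in
/-- A projection of infinite rank is the sum of the range projections of any prescribed positive
number of isometries with mutually orthogonal ranges. -/
theorem exists_isometries_of_infinite_rank
    {𝕜 H : Type*} [RCLike 𝕜] [NormedAddCommGroup H] [InnerProductSpace 𝕜 H]
    [CompleteSpace H] [TopologicalSpace.SeparableSpace H]
    (P : H →L[𝕜] H) (hP : IsSelfAdjoint P) (hPP : P ∘L P = P)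
    (hrank : ¬ FiniteDimensional 𝕜 (LinearMap.range (P : H →ₗ[𝕜] H))) (m : ℕ) (hm : 0 < m) :
    ∃ V : Fin m → lp (fun _ : ℕ => 𝕜) 2 →L[𝕜] H,
      (∀ k l, adjoint (V k) ∘L V l = if k = l then ContinuousLinearMap.id 𝕜 _ else 0) ∧
      ∑ k, V k ∘L adjoint (V k) = P := by
  have hPapp : ∀ x, P (P x) = P x := fun x => DFunLike.congr_fun hPP x
  set R := LinearMap.range (P : H →ₗ[𝕜] H)
  have hmem : ∀ x : R, P x = x := by
    rintro ⟨_, y, rfl⟩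
    exact hPapp y
  have hclosed : IsClosed (R : Set H) := by
    have : (R : Set H) = {x | P x = x} := by
      ext x
      exact ⟨fun hx => hmem ⟨x, hx⟩, fun hx => ⟨x, hx⟩⟩
    rw [this]
    exact isClosed_eq P.continuous continuous_id
  have : CompleteSpace R := hclosed.completeSpace_coe
  have : NeZero m := ⟨hm.ne'⟩
  have : SecondCountableTopology H := UniformSpace.secondCountable_of_separable H
  obtain ⟨b⟩ := nonempty_hilbertBasis_of_infinite 𝕜 R (Fin m × ℕ) hrank
  have hb : Orthonormal 𝕜 (fun a => (b a : H)) := b.orthonormal.comp_linearIsometry R.subtypeₗᵢ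
  have hbk : ∀ k, Orthonormal 𝕜 (fun n => (b (k, n) : H)) := fun k =>
    hb.comp (fun n => (k, n)) (fun _ _ h => (Prod.mk.inj h).2)
  let V : Fin m → lp (fun _ : ℕ => 𝕜) 2 →ₗᵢ[𝕜] H := fun k =>
    (hbk k).orthogonalFamily.linearIsometry
  have hVsum : ∀ k x, HasSum (fun n => x n • (b (k, n) : H)) (V k x) := fun k x =>
    (hbk k).orthogonalFamily.hasSum_linearIsometry x
  have hVsingle : ∀ k n, V k (lp.single 2 n 1) = b (k, n) := fun k n => by
    simp [V]
  have horth : ∀ k l, k ≠ l → ∀ x y, inner 𝕜 (V k x) (V l y) = 0 := by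
    intro k l hkl x y
    have h1 : ∀ n, inner 𝕜 (V k x) (b (l, n) : H) = 0 := by
      intro n
      have := (hVsum k x).mapL (innerSL 𝕜 (b (l, n) : H))
      have hne : ∀ p, (l, n) ≠ (k, p) := fun p h => hkl (Prod.mk.inj h).1.symm
      simp only [innerSL_apply_apply, inner_smul_right, fun p => hb.2 (hne p), mul_zero] at this
      exact inner_eq_zero_symm.mp (this.unique hasSum_zero)
    have := (hVsum l y).mapL (innerSL 𝕜 (V k x))
    simp only [innerSL_apply_apply, inner_smul_right, h1, mul_zero] at this
    exact this.unique hasSum_zero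
  have hVP : ∀ k x, P (V k x) = V k x := by
    intro k x
    have := (hVsum k x).mapL P
    simp only [map_smul, hmem] at this
    exact this.unique (hVsum k x)
  have hgram : ∀ k l, adjoint (V k).toContinuousLinearMap ∘L (V l).toContinuousLinearMap =
      if k = l then ContinuousLinearMap.id 𝕜 _ else 0 := by
    intro k l
    ext1 x
    refine ext_inner_left 𝕜 fun y => ?_
    rw [comp_apply, adjoint_inner_right]
    split_ifs with h
    · subst h
      exact (V k).inner_map_map y x
    · simpa using horth k l h y x
  refine ⟨fun k => (V k).toContinuousLinearMap, hgram, ?_⟩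
  set S := ∑ k, (V k).toContinuousLinearMap ∘L adjoint (V k).toContinuousLinearMap with hS
  have hSV : ∀ k x, S (V k x) = V k x := by
    intro k x
    have : ∀ l, adjoint (V l).toContinuousLinearMap (V k x) = if l = k then x else 0 := by
      intro l
      have := DFunLike.congr_fun (hgram l k) x
      split_ifs at this ⊢ <;> simpa using this
    simp [hS, sum_apply, this, apply_ite]
  have hSR : S ∘L R.subtypeL = R.subtypeL := by
    refine ContinuousLinearMap.ext_on (s := Set.range b) ?_ ?_
    · exact Submodule.dense_iff_topologicalClosure_eq_top.mpr b.dense_span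
    · rintro _ ⟨⟨k, n⟩, rfl⟩
      simpa [hVsingle] using hSV k (lp.single 2 n 1)
  have hSP : S ∘L P = P := by
    ext x
    exact DFunLike.congr_fun hSR ⟨P x, x, rfl⟩
  have hPS : P ∘L S = S := by
    ext x
    simp [hS, sum_apply, hVP]
  have hSadj : adjoint S = S := by
    simp [hS, adjoint_comp]
  have h := congrArg adjoint hPS
  rw [adjoint_comp, hSadj, isSelfAdjoint_iff'.mp hP, hSP] at h
  exact h.symm

open ContinuousLinearMap in
/-- A combination of mutually orthogonal projections with coefficients in `[0, 1]` is a
contraction. -/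
theorem norm_sum_smul_projection_le_one
    {𝕜 H ι : Type*} [RCLike 𝕜] [NormedAddCommGroup H] [InnerProductSpace 𝕜 H]
    [CompleteSpace H] [Fintype ι] (r : ι → ℝ) (hr0 : ∀ i, 0 ≤ r i) (hr1 : ∀ i, r i ≤ 1)
    (P : ι → (H →L[𝕜] H)) (hproj : ∀ i, IsSelfAdjoint (P i) ∧ (P i) ∘L (P i) = P i)
    (horth : ∀ i j, i ≠ j → (P i) ∘L (P j) = 0) :
    ‖∑ i, (r i : 𝕜) • P i‖ ≤ 1 := by
  classical
  have hinner : ∀ i j x, i ≠ j → inner 𝕜 (P i x) (P j x) = 0 := by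
    intro i j x hij
    rw [← adjoint_inner_right, isSelfAdjoint_iff'.mp (hproj i).1, ← comp_apply, horth i j hij]
    simp
  have hpyth : ∀ (a : ι → ℝ) x, ‖∑ i, (a i : 𝕜) • P i x‖ ^ 2 = ∑ i, a i ^ 2 * ‖P i x‖ ^ 2 := by
    intro a x
    rw [← RCLike.ofReal_inj (K := 𝕜)]
    push_cast
    rw [← inner_self_eq_norm_sq_to_K, sum_inner]
    refine Finset.sum_congr rfl fun i _ => ?_
    rw [inner_sum, Finset.sum_eq_single i]
    · rw [inner_smul_left, inner_smul_right, inner_self_eq_norm_sq_to_K, RCLike.conj_ofReal]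
      ring
    · intro j _ hji
      rw [inner_smul_left, inner_smul_right, hinner i j x hji.symm]
      simp
    · simp
  have hbessel : ∀ x, ∑ i, ‖P i x‖ ^ 2 ≤ ‖x‖ ^ 2 := by
    intro x
    have h1 : ‖∑ i, P i x‖ ^ 2 = ∑ i, ‖P i x‖ ^ 2 := by simpa using hpyth (fun _ => 1) x
    have h2 : ((∑ i, ‖P i x‖ ^ 2 : ℝ) : 𝕜) = inner 𝕜 x (∑ i, P i x) := by
      rw [inner_sum]
      push_cast
      refine Finset.sum_congr rfl fun i _ => ?_
      rw [← inner_self_eq_norm_sq_to_K, ← adjoint_inner_right, isSelfAdjoint_iff'.mp (hproj i).1,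
        ← comp_apply, (hproj i).2]
    have h3 : ∑ i, ‖P i x‖ ^ 2 ≤ ‖x‖ * ‖∑ i, P i x‖ := by
      have h := norm_inner_le_norm (𝕜 := 𝕜) x (∑ i, P i x)
      rw [← h2, RCLike.norm_ofReal] at h
      exact (le_abs_self _).trans h
    rw [← h1] at h3 ⊢
    have h4 : ‖∑ i, P i x‖ ≤ ‖x‖ := by
      by_contra! h
      nlinarith [norm_nonneg x]
    gcongr
  refine opNorm_le_bound _ zero_le_one fun x => ?_
  rw [one_mul, ← sq_le_sq₀ (norm_nonneg _) (norm_nonneg _)]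
  simp only [sum_apply, smul_apply]
  rw [hpyth]
  refine (Finset.sum_le_sum fun i _ => ?_).trans (hbessel x)
  exact mul_le_of_le_one_left (sq_nonneg _) (pow_le_one₀ (hr0 i) (hr1 i))

/-- Positive rationals, one of which exceeds `1`, have positive integer multiplicities for which the
weighted sum is an integer at least as large as the sum of the multiplicities. -/
theorem exists_multiplicities_sum_eq_nat {ι : Type*} [Fintype ι] (r : ι → ℚ)
    (hr : ∀ i, 0 < r i) (i₀ : ι) (hi₀ : 1 < r i₀) :
    ∃ (m : ι → ℕ) (T : ℕ), (∀ i, 0 < m i) ∧ ∑ i, (m i : ℚ) * r i = T ∧ ∑ i, m i ≤ T := by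
  classical
  obtain ⟨M, hM⟩ := exists_nat_ge ((∑ i, (1 - r i)) / (r i₀ - 1))
  let d : ℕ := ∏ i, (r i).den
  have hd : 0 < d := Finset.prod_pos fun i _ => (r i).den_pos
  have hint : ∀ i, ∃ z : ℕ, (d : ℚ) * r i = z := by
    intro i
    obtain ⟨e, he⟩ : (r i).den ∣ d := Finset.dvd_prod_of_mem _ (Finset.mem_univ i)
    refine ⟨e * (r i).num.toNat, ?_⟩
    have hnum : (((r i).num.toNat : ℤ) : ℚ) = (r i).num := by
      rw [Int.toNat_of_nonneg (Rat.num_nonneg.mpr (hr i).le)]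
    rw [he]
    push_cast at hnum ⊢
    rw [hnum, ← Rat.mul_den_eq_num (r i)]
    ring
  choose z hz using hint
  let c : ι → ℕ := fun i => if i = i₀ then M + 1 else 1
  refine ⟨fun i => d * c i, ∑ i, z i * c i, fun i => ?_, ?_, ?_⟩
  · refine Nat.mul_pos hd ?_
    simp only [c]
    split_ifs <;> omega
  · push_cast
    refine Finset.sum_congr rfl fun i _ => ?_
    rw [← hz]
    ring
  · rw [div_le_iff₀ (by linarith)] at hM
    have hc : ∀ i, (c i : ℚ) = 1 + if i = i₀ then (M : ℚ) else 0 := by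
      intro i
      simp only [c]
      split_ifs <;> push_cast <;> ring
    have hkey : 0 ≤ ∑ i, (c i : ℚ) * (r i - 1) := by
      simp only [hc, add_mul, one_mul, ite_mul, zero_mul, Finset.sum_add_distrib,
        Finset.sum_ite_eq', Finset.mem_univ, if_true]
      rw [← neg_le_iff_add_nonneg', ← Finset.sum_neg_distrib]
      simpa using hM
    rw [← Nat.cast_le (α := ℚ)]
    push_cast
    rw [← sub_nonneg, ← Finset.sum_sub_distrib]
    have : ∀ i, (z i : ℚ) * c i - d * c i = d * (c i * (r i - 1)) := fun i => by
      rw [← hz]; ring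
    simp only [this, ← Finset.mul_sum]
    positivity


/-- A positive operator on an infinite-dimensional separable Hilbert space
with finite rational spectrum, all of whose nonzero spectral projections are
infinite-dimensional, and with norm `> 1`, is a finite sum of self-adjoint projections.
Here `A` is given by its spectral decomposition `A = ∑ rᵢ Pᵢ` with distinct positive
rationals `rᵢ` and mutually orthogonal infinite-rank projections `Pᵢ`. -/
theorem finite_rational_spectrum_sum_of_projections
    {𝕜 H : Type*} [RCLike 𝕜] [NormedAddCommGroup H] [InnerProductSpace 𝕜 H]
    [CompleteSpace H] [TopologicalSpace.SeparableSpace H]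
    (hinf : ¬ FiniteDimensional 𝕜 H)
    (A : H →L[𝕜] H) (hA : A.IsPositive)
    (n : ℕ) (r : Fin n → ℚ) (hrpos : ∀ i, 0 < r i) (hrdist : Function.Injective r)
    (P : Fin n → (H →L[𝕜] H))
    (hproj : ∀ i, IsSelfAdjoint (P i) ∧ (P i) ∘L (P i) = P i)
    (horth : ∀ i j, i ≠ j → (P i) ∘L (P j) = 0)
    (hrank : ∀ i, ¬ FiniteDimensional 𝕜 (LinearMap.range ((P i) : H →ₗ[𝕜] H)))
    (hdecomp : A = ∑ i, ((r i : 𝕜) • P i))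
    (hnorm : 1 < ‖A‖) :
    ∃ (m : ℕ) (Q : Fin m → (H →L[𝕜] H)),
      (∀ l, IsSelfAdjoint (Q l) ∧ (Q l) ∘L (Q l) = Q l) ∧
      A = ∑ l, Q l := by
  open ContinuousLinearMap in
  classical
  obtain ⟨i₀, hi₀⟩ : ∃ i, 1 < r i := by
    by_contra! h
    refine hnorm.not_ge ?_
    rw [hdecomp]
    simpa using norm_sum_smul_projection_le_one (𝕜 := 𝕜) (fun i => (r i : ℝ))
      (fun i => mod_cast (hrpos i).le) (fun i => mod_cast h i) P hproj horth
  obtain ⟨m, T, hm, hT, hmT⟩ := exists_multiplicities_sum_eq_nat r hrpos i₀ hi₀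
  choose V hV hVP using fun i =>
    exists_isometries_of_infinite_rank (P i) (hproj i).1 (hproj i).2 (hrank i) (m i) (hm i)
  have hPV : ∀ i k, P i ∘L V i k = V i k := by
    intro i k
    rw [← hVP i]
    ext x
    have : ∀ l, adjoint (V i l) (V i k x) = if l = k then x else 0 := by
      intro l
      have := DFunLike.congr_fun (hV i l k) x
      split_ifs at this ⊢ <;> simpa using this
    simp [sum_apply, this, apply_ite]
  have hVV : ∀ i j k l, i ≠ j → adjoint (V i k) ∘L V j l = 0 := by
    intro i j k l hij
    rw [← hPV i k, ← hPV j l, adjoint_comp, isSelfAdjoint_iff'.mp (hproj i).1, comp_assoc,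
      ← comp_assoc (P i), horth i j hij]
    simp
  have hgram : ∀ a b : Σ i, Fin (m i), adjoint (V a.1 a.2) ∘L V b.1 b.2 =
      if a = b then ContinuousLinearMap.id 𝕜 _ else 0 := by
    rintro ⟨i, k⟩ ⟨j, l⟩
    by_cases hij : i = j
    · subst hij
      simp [hV]
    · simp [hVV i j k l hij, hij]
  have hsum : ∑ a : Σ i, Fin (m i), (r a.1 : ℝ) = T := by
    rw [Fintype.sum_sigma]
    simpa using mod_cast congrArg (Rat.cast (K := ℝ)) hT
  obtain ⟨N, Q, hQ, hQsum⟩ := exists_projections_of_weighted_isometries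
    (fun a : Σ i, Fin (m i) => V a.1 a.2) hgram (fun a => (r a.1 : ℝ))
    (fun a => mod_cast (hrpos a.1).le) T hsum (by simpa using hmT)
  refine ⟨N, Q, hQ, ?_⟩
  rw [← hQsum, hdecomp, Fintype.sum_sigma]
  simp [← Finset.smul_sum, hVP]
end

section
/- Let A be a positive operator on an infinite-dimensional separable Hilbert space all of whose nonzero spectral projections have infinite rank, and suppose ‖A‖ > 1. Then A admits a projection decomposition into infinite-rank self-adjoint projections, with strong operator convergence. -/
open Filter Topology

/-- In a Banach algebra, `1 - a` has a square root whenever `‖a‖ ≤ 1`, and the root lies in every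
closed set stable under the iteration `y ↦ (a + y ^ 2) / 2`. -/
theorem exists_sq_one_sub_eq_one_sub {R : Type*} [NormedRing R] [NormedAlgebra ℝ R]
    [CompleteSpace R] (a : R) (ha : ‖a‖ ≤ 1) {s : Set R} (hs : IsClosed s) (h0 : (0 : R) ∈ s)
    (hstep : ∀ y ∈ s, (2⁻¹ : ℝ) • (a + y * y) ∈ s) :
    ∃ y ∈ s, (1 - y) * (1 - y) = 1 - a := by
  let Y : ℕ → R := fun n => (fun y => (2⁻¹ : ℝ) • (a + y * y))^[n] 0
  let c : ℕ → ℝ := fun n => (fun y => 2⁻¹ * (1 + y * y))^[n] 0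
  have hY : ∀ n, Y (n + 1) = (2⁻¹ : ℝ) • (a + Y n * Y n) := fun n =>
    Function.iterate_succ_apply' _ _ _
  have hc : ∀ n, c (n + 1) = 2⁻¹ * (1 + c n * c n) := fun n =>
    Function.iterate_succ_apply' _ _ _
  have hcomm : ∀ n, Commute a (Y n) := by
    intro n
    induction n with
    | zero => exact Commute.zero_right a
    | succ n ih =>
      rw [hY]
      exact ((Commute.refl a).add_right (ih.mul_right ih)).smul_right _
  have hcomm' : ∀ n, Commute (Y (n + 1)) (Y n) := fun n => by
    rw [hY]
    exact ((hcomm n).add_left ((Commute.refl (Y n)).mul_left (Commute.refl _))).smul_left _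
  have hc1 : ∀ n, 0 ≤ c n ∧ c n ≤ 1 := by
    intro n
    induction n with
    | zero => simp [c]
    | succ n ih => rw [hc]; constructor <;> nlinarith
  have hYc : ∀ n, ‖Y n‖ ≤ c n := by
    intro n
    induction n with
    | zero => simp [Y, c]
    | succ n ih =>
      rw [hY, hc, norm_smul]
      have : ‖a + Y n * Y n‖ ≤ 1 + c n * c n :=
        (norm_add_le _ _).trans (add_le_add ha ((norm_mul_le _ _).trans
          (mul_le_mul ih ih (norm_nonneg _) (hc1 n).1)))
      rw [Real.norm_of_nonneg (by norm_num)]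
      linarith
  have hdiff : ∀ n, ‖Y (n + 1) - Y n‖ ≤ c (n + 1) - c n := by
    intro n
    induction n with
    | zero => simpa [Y, c] using (by rw [norm_smul]; norm_num; linarith : ‖(2⁻¹ : ℝ) • a‖ ≤ 2⁻¹)
    | succ n ih =>
      have h : Y (n + 2) - Y (n + 1) =
          (2⁻¹ : ℝ) • ((Y (n + 1) + Y n) * (Y (n + 1) - Y n)) := by
        calc Y (n + 2) - Y (n + 1)
            = (2⁻¹ : ℝ) • (a + Y (n + 1) * Y (n + 1)) - (2⁻¹ : ℝ) • (a + Y n * Y n) := by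
              rw [← hY, ← hY]
          _ = _ := by
              rw [← smul_sub, add_sub_add_left_eq_sub, (hcomm' n).mul_self_sub_mul_self_eq]
      rw [h, norm_smul, Real.norm_of_nonneg (by norm_num), hc (n + 1)]
      have h2 : ‖(Y (n + 1) + Y n) * (Y (n + 1) - Y n)‖ ≤ (c (n + 1) + c n) * (c (n + 1) - c n) :=
        (norm_mul_le _ _).trans (mul_le_mul ((norm_add_le _ _).trans (add_le_add (hYc _) (hYc _)))
          ih (norm_nonneg _) (add_nonneg (hc1 _).1 (hc1 _).1))
      nlinarith [hc n]
  have hmono : Monotone c := monotone_nat_of_le_succ fun n => by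
    linarith [(norm_nonneg _).trans (hdiff n)]
  have hsum : Summable fun n => c (n + 1) - c n := by
    refine summable_of_sum_range_le (c := 1) (fun n => (norm_nonneg _).trans (hdiff n)) fun n => ?_
    rw [Finset.sum_range_sub]
    have : c 0 = 0 := rfl
    linarith [(hc1 n).2]
  have hcau : CauchySeq Y := cauchySeq_of_dist_le_of_summable _
    (fun n => by rw [dist_comm, dist_eq_norm]; exact hdiff n) hsum
  obtain ⟨y, hy⟩ := cauchySeq_tendsto_of_complete hcau
  have hmem : ∀ n, Y n ∈ s := by
    intro n
    induction n with
    | zero => exact h0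
    | succ n ih => rw [hY]; exact hstep _ ih
  refine ⟨y, hs.mem_of_tendsto hy (Eventually.of_forall hmem), ?_⟩
  have hlim : Tendsto (fun n => Y (n + 1)) atTop (𝓝 ((2⁻¹ : ℝ) • (a + y * y))) := by
    simp_rw [hY]
    exact (tendsto_const_nhds.add (hy.mul hy)).const_smul _
  have heq := tendsto_nhds_unique ((tendsto_add_atTop_iff_nat 1).2 hy) hlim
  have h2 : (2 : ℝ) • y = a + y * y := by
    rw [heq, smul_smul, ← heq]; norm_num
  rw [two_smul] at h2
  have : a = y + y - y * y := by rw [h2]; abel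
  rw [this]
  noncomm_ring

section

variable {𝕜 H : Type*} [RCLike 𝕜] [NormedAddCommGroup H] [InnerProductSpace 𝕜 H]

theorem ContinuousLinearMap.IsPositive.norm_apply_sq_le {A : H →L[𝕜] H} (hA : A.IsPositive)
    (x : H) : ‖A x‖ ^ 2 ≤ ‖A‖ * RCLike.re (inner 𝕜 (A x) x) := by
  rcases eq_or_ne ‖A‖ 0 with h | h
  · simp [norm_eq_zero.1 h]
  have hm : 0 < ‖A‖ := lt_of_le_of_ne (norm_nonneg _) h.symm
  have h1 := hA.re_inner_nonneg_left ((‖A‖ : 𝕜) • x - A x)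
  have h2 : RCLike.re (inner 𝕜 (A (A x)) (A x)) ≤ ‖A‖ * ‖A x‖ ^ 2 := by
    refine (RCLike.re_le_norm _).trans ((norm_inner_le_norm _ _).trans ?_)
    nlinarith [A.le_opNorm (A x), norm_nonneg (A x)]
  have h3 : RCLike.re (inner 𝕜 (A (A x)) x) = ‖A x‖ ^ 2 := by
    rw [hA.inner_left_eq_inner_right, inner_self_eq_norm_sq]
  have h4 : RCLike.re (inner 𝕜 (A x) (A x)) = ‖A x‖ ^ 2 := inner_self_eq_norm_sq _
  simp only [map_sub, map_smul, inner_sub_left, inner_sub_right, inner_smul_left,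
    inner_smul_right, RCLike.conj_ofReal, RCLike.re_ofReal_mul, h3, h4] at h1
  have h5 : 0 ≤ ‖A‖ * (‖A‖ * RCLike.re (inner 𝕜 (A x) x) - ‖A x‖ ^ 2) := by nlinarith
  linarith [nonneg_of_mul_nonneg_right h5 hm]

theorem ContinuousLinearMap.IsPositive.norm_smul_sub_apply_sq_le {A : H →L[𝕜] H}
    (hA : A.IsPositive) (x : H) :
    ‖(‖A‖ : 𝕜) • x - A x‖ ^ 2 ≤ ‖A‖ ^ 2 * ‖x‖ ^ 2 - ‖A x‖ ^ 2 := by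
  rw [@norm_sub_sq 𝕜, norm_smul, inner_smul_left, RCLike.conj_ofReal, RCLike.re_ofReal_mul,
    ← hA.inner_left_eq_inner_right, RCLike.norm_ofReal, abs_norm]
  nlinarith [hA.norm_apply_sq_le x]

theorem ContinuousLinearMap.IsPositive.exists_isSelfAdjoint_mul_self_eq [CompleteSpace H]
    {A : H →L[𝕜] H} (hA : A.IsPositive) : ∃ S : H →L[𝕜] H, IsSelfAdjoint S ∧ S * S = A := by
  rcases eq_or_ne ‖A‖ 0 with h | h
  · exact ⟨0, .zero _, by simp [norm_eq_zero.1 h]⟩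
  have hm : 0 < ‖A‖ := lt_of_le_of_ne (norm_nonneg _) h.symm
  let _ : NormedAlgebra ℝ (H →L[𝕜] H) := NormedAlgebra.restrictScalars ℝ 𝕜 _
  have hsm : ∀ (r : ℝ) (B : H →L[𝕜] H), r • B = (r : 𝕜) • B := fun r B =>
    RCLike.real_smul_eq_coe_smul r B
  have hsa : ∀ (r : ℝ) (B : H →L[𝕜] H), IsSelfAdjoint B → IsSelfAdjoint (r • B) := by
    intro r B hB
    rw [hsm]
    exact IsSelfAdjoint.smul (RCLike.conj_ofReal r) hB
  have hX : ‖1 - ‖A‖⁻¹ • A‖ ≤ 1 := by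
    refine ContinuousLinearMap.opNorm_le_bound _ zero_le_one fun x => ?_
    have h1 := hA.norm_smul_sub_apply_sq_le x
    have h2 : (1 - ‖A‖⁻¹ • A) x = ((‖A‖⁻¹ : ℝ) : 𝕜) • ((‖A‖ : 𝕜) • x - A x) := by
      rw [hsm, smul_sub, smul_smul, ← RCLike.ofReal_mul, inv_mul_cancel₀ h]
      simp
    rw [h2, norm_smul, RCLike.norm_ofReal, abs_of_nonneg (inv_nonneg.2 hm.le), one_mul,
      inv_mul_le_iff₀ hm]
    refine abs_le_of_sq_le_sq' ?_ (by positivity) |>.2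
    nlinarith [sq_nonneg ‖A x‖]
  obtain ⟨y, hy, hy2⟩ := exists_sq_one_sub_eq_one_sub _ hX
    (s := {B : H →L[𝕜] H | IsSelfAdjoint B}) (isClosed_eq continuous_star continuous_id)
    (IsSelfAdjoint.zero _) (fun y hy => hsa _ _
      (((IsSelfAdjoint.one _).sub (hsa _ _ hA.isSelfAdjoint)).add (by
        simp only [Set.mem_ofPred_eq, isSelfAdjoint_iff] at hy ⊢
        rw [star_mul, hy])))
  refine ⟨Real.sqrt ‖A‖ • (1 - y), hsa _ _ ((IsSelfAdjoint.one _).sub hy), ?_⟩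
  rw [smul_mul_smul_comm, hy2, Real.mul_self_sqrt hm.le, sub_sub_cancel, smul_smul,
    mul_inv_cancel₀ h, one_smul]

theorem Submodule.exists_mem_orthogonal_norm_eq_one {E F : Submodule 𝕜 H}
    (hE : ¬ FiniteDimensional 𝕜 E) [FiniteDimensional 𝕜 F] :
    ∃ x ∈ E, x ∈ Fᗮ ∧ ‖x‖ = 1 := by
  have hni : ¬ Function.Injective (F.orthogonalProjectionOnto.toLinearMap ∘ₗ E.subtype) :=
    fun h => hE (FiniteDimensional.of_injective _ h)
  rw [← LinearMap.ker_eq_bot, Submodule.eq_bot_iff] at hni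
  push Not at hni
  obtain ⟨x, hx, hx0⟩ := hni
  have hxF : (x : H) ∈ Fᗮ := by
    rw [LinearMap.mem_ker] at hx
    exact Submodule.orthogonalProjectionOnto_eq_zero_iff.1 hx
  have hx0' : (x : H) ≠ 0 := by simpa using hx0
  exact ⟨((‖(x : H)‖⁻¹ : ℝ) : 𝕜) • (x : H), E.smul_mem _ x.2, Fᗮ.smul_mem _ hxF,
    by simp [norm_smul, hx0']⟩

/-- Approximate eigenvectors of a self-adjoint operator without eigenvectors converge weakly to
zero. -/
theorem tendsto_inner_zero_of_ker_eq_bot [CompleteSpace H] {B : H →L[𝕜] H}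
    (hB : IsSelfAdjoint B) (hker : B.ker = ⊥) {x : ℕ → H} (hx : ∀ n, ‖x n‖ ≤ 1)
    (hBx : Tendsto (fun n => B (x n)) atTop (𝓝 0)) (f : H) :
    Tendsto (fun n => inner 𝕜 f (x n)) atTop (𝓝 0) := by
  have hdense : f ∈ B.range.topologicalClosure := by
    rw [← Submodule.orthogonal_orthogonal_eq_closure, ContinuousLinearMap.orthogonal_range,
      hB.adjoint_eq, hker, Submodule.bot_orthogonal_eq_top]
    trivial
  rw [Metric.tendsto_atTop]
  intro ε hε
  obtain ⟨_, ⟨g, rfl⟩, hg⟩ := Metric.mem_closure_iff.1 hdense (ε / 2) (by positivity)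
  have h1 : Tendsto (fun n => ‖g‖ * ‖B (x n)‖) atTop (𝓝 0) := by
    simpa using (hBx.norm.const_mul ‖g‖)
  obtain ⟨N, hN⟩ := eventually_atTop.1 (h1.eventually (gt_mem_nhds (half_pos hε)))
  refine ⟨N, fun n hn => ?_⟩
  have h2 : inner 𝕜 f (x n) = inner 𝕜 (f - B g) (x n) + inner 𝕜 g (B (x n)) := by
    rw [inner_sub_left, ← ContinuousLinearMap.adjoint_inner_left, hB.adjoint_eq]; ring
  rw [dist_zero_right, h2]
  refine (norm_add_le _ _).trans_lt ?_
  have h3 : ‖inner 𝕜 (f - B g) (x n)‖ ≤ ‖f - B g‖ :=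
    (norm_inner_le_norm _ _).trans (mul_le_of_le_one_right (norm_nonneg _) (hx n))
  have h4 := norm_inner_le_norm (𝕜 := 𝕜) g (B (x n))
  have h5 : ‖f - B g‖ < ε / 2 := by rw [← dist_eq_norm]; exact hg
  linarith [hN n hn]

theorem exists_norm_eq_one_tendsto_norm_smul_sub [CompleteSpace H] {A : H →L[𝕜] H}
    (hA : A.IsPositive) (hA0 : A ≠ 0) :
    ∃ x : ℕ → H, (∀ n, ‖x n‖ = 1) ∧
      Tendsto (fun n => (‖A‖ : 𝕜) • x n - A (x n)) atTop (𝓝 0) := by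
  have hm : 0 < ‖A‖ := norm_pos_iff.2 hA0
  have hex : ∀ r < ‖A‖, ∃ x : H, ‖x‖ = 1 ∧ r < ‖A x‖ := by
    intro r hr
    by_contra! hcon
    have hr0 : 0 ≤ max r 0 := le_max_right _ _
    refine (max_lt hr hm).not_ge (A.opNorm_le_bound hr0 fun x => ?_)
    rcases eq_or_ne x 0 with rfl | hx
    · simp
    have hx' : 0 < ‖x‖ := norm_pos_iff.2 hx
    have := hcon (((‖x‖⁻¹ : ℝ) : 𝕜) • x) (by simp [norm_smul, hx])
    rw [map_smul, norm_smul, RCLike.norm_ofReal, abs_of_nonneg (by positivity),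
      inv_mul_le_iff₀ hx', mul_comm] at this
    exact this.trans (mul_le_mul_of_nonneg_right (le_max_left _ _) hx'.le)
  choose x hx1 hx using fun n : ℕ => hex (‖A‖ - 1 / ((n : ℝ) + 1))
    (sub_lt_self _ (by positivity))
  refine ⟨x, hx1, ?_⟩
  have hlim : Tendsto (fun n => ‖A (x n)‖) atTop (𝓝 ‖A‖) := by
    refine tendsto_of_tendsto_of_tendsto_of_le_of_le
      (g := fun n : ℕ => ‖A‖ - 1 / ((n : ℝ) + 1)) (h := fun _ => ‖A‖) ?_ tendsto_const_nhds
      (fun n => (hx n).le) (fun n => A.unit_le_opNorm _ (hx1 n).le)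
    simpa using (tendsto_const_nhds (x := ‖A‖)).sub
      (tendsto_one_div_add_atTop_nhds_zero_nat (𝕜 := ℝ))
  rw [tendsto_zero_iff_norm_tendsto_zero]
  have hsq : Tendsto (fun n => ‖(‖A‖ : 𝕜) • x n - A (x n)‖ ^ 2) atTop (𝓝 0) := by
    refine squeeze_zero (fun n => sq_nonneg _)
      (fun n => (hA.norm_smul_sub_apply_sq_le (x n))) ?_
    have := (tendsto_const_nhds (x := ‖A‖ ^ 2)).sub (hlim.pow 2)
    rw [sub_self] at this
    simpa [hx1] using this
  simpa using hsq.sqrt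

theorem Submodule.tendsto_starProjection_zero {F : Submodule 𝕜 H} [FiniteDimensional 𝕜 F]
    {x : ℕ → H} (hx : ∀ f : H, Tendsto (fun n => inner 𝕜 f (x n)) atTop (𝓝 0)) :
    Tendsto (fun n => F.starProjection (x n)) atTop (𝓝 0) := by
  have h : ∀ n, F.starProjection (x n) = ∑ i, inner 𝕜 ((stdOrthonormalBasis 𝕜 F i : F) : H) (x n) •
      ((stdOrthonormalBasis 𝕜 F i : F) : H) := fun n => by
    rw [(stdOrthonormalBasis 𝕜 F).starProjection_eq_sum_rankOne]
    simp
  simp_rw [h]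
  have := tendsto_finsetSum Finset.univ fun i (_ : i ∈ Finset.univ) =>
    (hx ((stdOrthonormalBasis 𝕜 F i : F) : H)).smul_const ((stdOrthonormalBasis 𝕜 F i : F) : H)
  simpa using this

/-- If the eigenspace of a positive operator `A` at `‖A‖` is trivial or infinite-dimensional, then
`‖A‖` is approached by the quadratic form of `A` on every subspace of finite codimension. -/
theorem ContinuousLinearMap.IsPositive.exists_mem_orthogonal_lt_re_inner [CompleteSpace H]
    {A : H →L[𝕜] H} (hA : A.IsPositive) (hA0 : A ≠ 0)
    (hspec : Module.End.eigenspace (A : H →ₗ[𝕜] H) (‖A‖ : 𝕜) = ⊥ ∨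
      ¬ FiniteDimensional 𝕜 (Module.End.eigenspace (A : H →ₗ[𝕜] H) (‖A‖ : 𝕜)))
    (F : Submodule 𝕜 H) [FiniteDimensional 𝕜 F] {s : ℝ} (hs : s < ‖A‖) :
    ∃ x ∈ Fᗮ, ‖x‖ = 1 ∧ s < RCLike.re (inner 𝕜 (A x) x) := by
  rcases hspec with hbot | hinf
  · obtain ⟨x, hx1, hx⟩ := exists_norm_eq_one_tendsto_norm_smul_sub hA hA0
    have hsa : IsSelfAdjoint ((‖A‖ : 𝕜) • (1 : H →L[𝕜] H) - A) :=
      (IsSelfAdjoint.smul (RCLike.conj_ofReal _) (IsSelfAdjoint.one _)).sub hA.isSelfAdjoint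
    have hker : ((‖A‖ : 𝕜) • (1 : H →L[𝕜] H) - A).ker = ⊥ := by
      rw [eq_bot_iff, ← hbot]
      intro z hz
      rw [Module.End.mem_eigenspace_iff]
      exact (sub_eq_zero.1 hz).symm
    have hweak := tendsto_inner_zero_of_ker_eq_bot hsa hker (fun n => (hx1 n).le) hx
    have hp := Submodule.tendsto_starProjection_zero (F := F) hweak
    by_contra! hcon
    have hcon' : ∀ z ∈ Fᗮ, RCLike.re (inner 𝕜 (A z) z) ≤ s * ‖z‖ ^ 2 := by
      intro z hz
      rcases eq_or_ne z 0 with rfl | hz0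
      · simp
      have hz' : 0 < ‖z‖ := norm_pos_iff.2 hz0
      have := hcon (((‖z‖⁻¹ : ℝ) : 𝕜) • z) (Fᗮ.smul_mem _ hz) (by simp [norm_smul, hz0])
      rw [map_smul, inner_smul_left, inner_smul_right, RCLike.conj_ofReal,
        RCLike.re_ofReal_mul, RCLike.re_ofReal_mul, inv_mul_le_iff₀ hz', inv_mul_le_iff₀ hz']
        at this
      linarith
    have hq : Tendsto (fun n => inner 𝕜 (((‖A‖ : 𝕜) • (1 : H →L[𝕜] H) - A)
        (x n - F.starProjection (x n))) (x n - F.starProjection (x n))) atTop (𝓝 0) := by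
      have h1 : Tendsto (fun n => ((‖A‖ : 𝕜) • (1 : H →L[𝕜] H) - A)
          (x n - F.starProjection (x n))) atTop (𝓝 0) := by
        have := hx.sub ((((‖A‖ : 𝕜) • (1 : H →L[𝕜] H) - A).continuous.tendsto 0).comp hp)
        simp only [map_zero, sub_zero] at this
        refine this.congr fun n => ?_
        simp [smul_sub]
        abel
      refine squeeze_zero_norm (fun n => (norm_inner_le_norm _ _).trans
        (mul_le_of_le_one_right (norm_nonneg _) ?_)) (by simpa using h1.norm)
      rw [← Submodule.starProjection_orthogonal_val, ← hx1 n]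
      exact Submodule.norm_starProjection_apply_le _ _
    have hn : Tendsto (fun n => ‖x n - F.starProjection (x n)‖) atTop (𝓝 1) := by
      have h1 : Tendsto (fun n => ‖F.starProjection (x n)‖) atTop (𝓝 0) := by simpa using hp.norm
      refine tendsto_of_tendsto_of_tendsto_of_le_of_le
        (g := fun n => 1 - ‖F.starProjection (x n)‖) (h := fun n => 1 + ‖F.starProjection (x n)‖)
        (by simpa using tendsto_const_nhds.sub h1) (by simpa using tendsto_const_nhds.add h1)
        (fun n => ?_) (fun n => ?_)
      · simpa [hx1] using norm_sub_norm_le (x n) (F.starProjection (x n))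
      · simpa [hx1] using norm_sub_le (x n) (F.starProjection (x n))
    have hle : ∀ n, (‖A‖ - s) * ‖x n - F.starProjection (x n)‖ ^ 2 ≤
        RCLike.re (inner 𝕜 (((‖A‖ : 𝕜) • (1 : H →L[𝕜] H) - A)
        (x n - F.starProjection (x n))) (x n - F.starProjection (x n))) := by
      intro n
      have h1 := hcon' _ (F.sub_starProjection_mem_orthogonal (x n))
      generalize x n - F.starProjection (x n) = z at h1 ⊢
      have h2 : ((‖A‖ : 𝕜) • (1 : H →L[𝕜] H) - A) z = (‖A‖ : 𝕜) • z - A z := rfl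
      rw [h2, inner_sub_left, inner_smul_left, RCLike.conj_ofReal, map_sub, RCLike.re_ofReal_mul,
        inner_self_eq_norm_sq]
      linarith
    have hfin := le_of_tendsto_of_tendsto' ((hn.pow 2).const_mul (‖A‖ - s))
      ((RCLike.continuous_re.tendsto _).comp hq) hle
    simp only [one_pow, mul_one, map_zero] at hfin
    linarith
  · obtain ⟨x, hxE, hxF, hx1⟩ := Submodule.exists_mem_orthogonal_norm_eq_one (F := F) hinf
    refine ⟨x, hxF, hx1, ?_⟩
    have : A x = (‖A‖ : 𝕜) • x := Module.End.mem_eigenspace_iff.1 hxE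
    rw [this, inner_smul_left, RCLike.conj_ofReal, RCLike.re_ofReal_mul, inner_self_eq_norm_sq,
      hx1]
    simpa using hs

theorem exists_seq_of_forall_fin {α : Type*} {Q : (n : ℕ) → (Fin n → α) → α → Prop}
    (h : ∀ n v, ∃ x, Q n v x) : ∃ u : ℕ → α, ∀ n, Q n (fun k => u k) (u n) := by
  choose g hg using h
  let u : ℕ → α := fun n => Nat.strongRec (fun n ih => g n fun k => ih k k.2) n
  have hu : ∀ n, u n = g n fun k => u k := fun n => by
    simp only [u]
    rw [Nat.strongRec_eq]
  exact ⟨u, fun n => by rw [hu n]; exact hg n _⟩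

theorem norm_sqrt_smul_add_sqrt_smul_sq {x y : H} (hxy : inner 𝕜 x y = 0) {c d : ℝ} (hc : 0 ≤ c)
    (hd : 0 ≤ d) :
    ‖(Real.sqrt c : 𝕜) • x + (Real.sqrt d : 𝕜) • y‖ ^ 2 = c * ‖x‖ ^ 2 + d * ‖y‖ ^ 2 := by
  rw [@norm_add_sq 𝕜, inner_smul_left, inner_smul_right, hxy, norm_smul, norm_smul,
    RCLike.norm_ofReal, RCLike.norm_ofReal, mul_pow, mul_pow, sq_abs, sq_abs, Real.sq_sqrt hc,
    Real.sq_sqrt hd]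
  simp

variable {K : Type*} [NormedAddCommGroup K] [InnerProductSpace 𝕜 K]

theorem exists_mem_orthogonal_norm_apply_sq_eq {T : K →L[𝕜] H}
    (hker : ¬ FiniteDimensional 𝕜 T.ker) {m : ℝ}
    (hT : ∀ F : Submodule 𝕜 K, FiniteDimensional 𝕜 F → ∃ x ∈ Fᗮ, ‖x‖ = 1 ∧ m ≤ ‖T x‖ ^ 2)
    (F : Submodule 𝕜 K) [FiniteDimensional 𝕜 F] {s : ℝ} (hs0 : 0 < s) (hsm : s ≤ m) :
    ∃ x ∈ Fᗮ, ‖x‖ = 1 ∧ ‖T x‖ ^ 2 = s := by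
  obtain ⟨x, hxF, hx1, hx⟩ := hT F inferInstance
  obtain ⟨y, hy, hyF, hy1⟩ := Submodule.exists_mem_orthogonal_norm_eq_one
    (F := F ⊔ Submodule.span 𝕜 {x}) hker
  rw [← Submodule.inf_orthogonal, Submodule.mem_inf,
    Submodule.mem_orthogonal_singleton_iff_inner_right] at hyF
  have hTy : T y = 0 := hy
  have hTx : 0 < ‖T x‖ ^ 2 := by linarith
  have hc : s / ‖T x‖ ^ 2 ≤ 1 := (div_le_one hTx).2 (hsm.trans hx)
  refine ⟨(Real.sqrt (s / ‖T x‖ ^ 2) : 𝕜) • x + (Real.sqrt (1 - s / ‖T x‖ ^ 2) : 𝕜) • y,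
    Fᗮ.add_mem (Fᗮ.smul_mem _ hxF) (Fᗮ.smul_mem _ hyF.1), ?_, ?_⟩
  · refine (pow_eq_one_iff_of_nonneg (norm_nonneg _) two_ne_zero).1 ?_
    rw [norm_sqrt_smul_add_sqrt_smul_sq hyF.2 (by positivity) (by linarith), hx1, hy1]
    ring
  · rw [map_add, map_smul, map_smul, norm_sqrt_smul_add_sqrt_smul_sq (by simp [hTy])
      (by positivity) (by linarith), hTy, norm_zero, div_mul_cancel₀ _ hTx.ne']
    ring

variable [CompleteSpace H] [CompleteSpace K]

/-- A unit vector `u` orthogonal to `F` with `‖T u‖ = 1` that captures a fixed proportion of the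
component of `d` orthogonal to `F`. -/
theorem exists_mem_orthogonal_norm_apply_eq_one {T : K →L[𝕜] H}
    (hker : ¬ FiniteDimensional 𝕜 T.ker) {m : ℝ} (hm : 1 < m)
    (hT : ∀ F : Submodule 𝕜 K, FiniteDimensional 𝕜 F → ∃ x ∈ Fᗮ, ‖x‖ = 1 ∧ m ≤ ‖T x‖ ^ 2) :
    ∃ c : ℝ, 0 < c ∧ ∀ (F : Submodule 𝕜 K) (_ : FiniteDimensional 𝕜 F) (d : K),
      ∃ u ∈ Fᗮ, ‖u‖ = 1 ∧ ‖T u‖ = 1 ∧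
        ∀ z ∈ Fᗮ, c * ‖inner 𝕜 z d‖ ^ 2 ≤ ‖inner 𝕜 u d‖ ^ 2 * ‖z‖ ^ 2 := by
  obtain ⟨c, hc0, hc1, hcT, hcm⟩ : ∃ c : ℝ, 0 < c ∧ c < 1 ∧ c * ‖T‖ ^ 2 < 1 ∧ 1 ≤ (1 - c) * m := by
    have h1 : 0 < (1 + ‖T‖ ^ 2)⁻¹ := by positivity
    have h2 : 0 < (m - 1) / m := by apply div_pos <;> linarith
    refine ⟨min (1 + ‖T‖ ^ 2)⁻¹ ((m - 1) / m), lt_min h1 h2, ?_, ?_, ?_⟩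
    · refine (min_le_right _ _).trans_lt ?_
      rw [div_lt_one (by linarith)]; linarith
    · refine (mul_le_mul_of_nonneg_right (min_le_left _ _) (sq_nonneg _)).trans_lt ?_
      rw [inv_mul_lt_iff₀ (by positivity)]; linarith
    · have h3 := mul_le_mul_of_nonneg_right
        (min_le_right (1 + ‖T‖ ^ 2)⁻¹ ((m - 1) / m)) (by linarith : 0 ≤ m)
      rw [div_mul_cancel₀ _ (by linarith)] at h3
      linarith
  refine ⟨c, hc0, fun F _ d => ?_⟩
  have hd : ∀ z ∈ Fᗮ, inner 𝕜 z d = inner 𝕜 z (d - F.starProjection d) := fun z hz => by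
    rw [inner_sub_right, Submodule.inner_left_of_mem_orthogonal (F.starProjection_apply_mem d) hz,
      sub_zero]
  have hr := F.sub_starProjection_mem_orthogonal d
  generalize d - F.starProjection d = r at hd hr
  rcases eq_or_ne r 0 with rfl | hr0
  · obtain ⟨u, hu, hu1, hTu⟩ :=
      exists_mem_orthogonal_norm_apply_sq_eq hker hT F one_pos hm.le
    refine ⟨u, hu, hu1, (pow_eq_one_iff_of_nonneg (norm_nonneg _) two_ne_zero).1 hTu,
      fun z hz => ?_⟩
    rw [hd z hz, inner_zero_right, norm_zero]
    simpa using by positivity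
  have hrn : 0 < ‖r‖ := norm_pos_iff.2 hr0
  obtain ⟨h, hh⟩ : ∃ h, h = ((‖r‖⁻¹ : ℝ) : 𝕜) • r := ⟨_, rfl⟩
  have hh1 : ‖h‖ = 1 := by simp [hh, norm_smul, hr0]
  have hhF : h ∈ Fᗮ := hh ▸ Fᗮ.smul_mem _ hr
  have hrh : r = (‖r‖ : 𝕜) • h := by
    rw [hh, smul_smul, ← RCLike.ofReal_mul, mul_inv_cancel₀ hrn.ne', RCLike.ofReal_one, one_smul]
  have hTh : ‖T h‖ ^ 2 ≤ ‖T‖ ^ 2 := by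
    gcongr
    exact T.unit_le_opNorm _ hh1.le
  have hct : c * ‖T h‖ ^ 2 < 1 := (mul_le_mul_of_nonneg_left hTh hc0.le).trans_lt hcT
  have hc1' : 0 < 1 - c := by linarith
  obtain ⟨g, hg, hg1, hTg⟩ := exists_mem_orthogonal_norm_apply_sq_eq hker hT
    (F ⊔ Submodule.span 𝕜 {h} ⊔ Submodule.span 𝕜 {T.adjoint (T h)})
    (s := (1 - c * ‖T h‖ ^ 2) / (1 - c)) (div_pos (by linarith) hc1') (by
      rw [div_le_iff₀ hc1']
      nlinarith [mul_nonneg hc0.le (sq_nonneg ‖T h‖)])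
  rw [← Submodule.inf_orthogonal, ← Submodule.inf_orthogonal, Submodule.mem_inf, Submodule.mem_inf,
    Submodule.mem_orthogonal_singleton_iff_inner_right,
    Submodule.mem_orthogonal_singleton_iff_inner_right, ContinuousLinearMap.adjoint_inner_left]
    at hg
  obtain ⟨⟨hgF, hgh⟩, hgT⟩ := hg
  have huF : (Real.sqrt c : 𝕜) • h + (Real.sqrt (1 - c) : 𝕜) • g ∈ Fᗮ :=
    Fᗮ.add_mem (Fᗮ.smul_mem _ hhF) (Fᗮ.smul_mem _ hgF)
  refine ⟨_, huF, ?_, ?_, fun z hz => ?_⟩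
  · refine (pow_eq_one_iff_of_nonneg (norm_nonneg _) two_ne_zero).1 ?_
    rw [norm_sqrt_smul_add_sqrt_smul_sq hgh hc0.le hc1'.le, hh1, hg1]
    ring
  · refine (pow_eq_one_iff_of_nonneg (norm_nonneg _) two_ne_zero).1 ?_
    rw [map_add, map_smul, map_smul, norm_sqrt_smul_add_sqrt_smul_sq hgT hc0.le hc1'.le, hTg]
    field_simp
    ring
  · have h1 : inner 𝕜 ((Real.sqrt c : 𝕜) • h + (Real.sqrt (1 - c) : 𝕜) • g) r =
        (Real.sqrt c : 𝕜) * ‖r‖ := by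
      rw [hrh, inner_smul_right, inner_add_left, inner_smul_left, inner_smul_left,
        inner_eq_zero_symm.1 hgh, inner_self_eq_norm_sq_to_K, hh1, norm_smul, hh1]
      simp [mul_comm]
    rw [hd z hz, hd _ huF, h1, norm_mul, mul_pow, RCLike.norm_ofReal, sq_abs,
      Real.sq_sqrt hc0.le, RCLike.norm_ofReal, abs_norm, mul_assoc]
    refine mul_le_mul_of_nonneg_left ?_ hc0.le
    rw [← mul_pow, mul_comm ‖r‖]
    gcongr
    exact norm_inner_le_norm _ _

/-- A Hilbert basis of `K`, partitioned into infinitely many infinite blocks, on each of which `T`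
is isometric. -/
theorem exists_hilbertBasis_orthonormal_blocks [TopologicalSpace.SeparableSpace K]
    {T : K →L[𝕜] H} (hker : ¬ FiniteDimensional 𝕜 T.ker) {m : ℝ} (hm : 1 < m)
    (hT : ∀ F : Submodule 𝕜 K, FiniteDimensional 𝕜 F → ∃ x ∈ Fᗮ, ‖x‖ = 1 ∧ m ≤ ‖T x‖ ^ 2) :
    ∃ u : HilbertBasis (ℕ × ℕ) 𝕜 K, ∀ i, Orthonormal 𝕜 fun j => T (u (i, j)) := by
  obtain ⟨c, hc0, hc⟩ := exists_mem_orthogonal_norm_apply_eq_one hker hm hT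
  let d : ℕ → K := TopologicalSpace.denseSeq K
  let F : (n : ℕ) → (Fin n → K) → Submodule 𝕜 K := fun n v =>
    Submodule.span 𝕜 (Set.range v ∪
      Set.image (fun k => T.adjoint (T (v k))) {k | (Nat.unpair k).1 = (Nat.unpair n).1})
  obtain ⟨u, hu⟩ := exists_seq_of_forall_fin
    (Q := fun n v x => x ∈ (F n v)ᗮ ∧ ‖x‖ = 1 ∧ ‖T x‖ = 1 ∧ ∀ z ∈ (F n v)ᗮ,
      c * ‖inner 𝕜 z (d (Nat.unpair (Nat.unpair n).1).1)‖ ^ 2 ≤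
        ‖inner 𝕜 x (d (Nat.unpair (Nat.unpair n).1).1)‖ ^ 2 * ‖z‖ ^ 2)
    (fun n v => hc (F n v) (FiniteDimensional.span_of_finite 𝕜
      ((Set.finite_range v).union (Set.toFinite _))) _)
  have hinner : ∀ k n, k < n → inner 𝕜 (u k) (u n) = 0 := fun k n hkn =>
    (Submodule.mem_orthogonal _ _).1 (hu n).1 _
      (Submodule.subset_span (Or.inl ⟨⟨k, hkn⟩, rfl⟩))
  have hTinner : ∀ k n, k < n → (Nat.unpair k).1 = (Nat.unpair n).1 →
      inner 𝕜 (T (u k)) (T (u n)) = 0 := fun k n hkn hb => by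
    rw [← ContinuousLinearMap.adjoint_inner_left]
    exact (Submodule.mem_orthogonal _ _).1 (hu n).1 _
      (Submodule.subset_span (Or.inr ⟨⟨k, hkn⟩, hb, rfl⟩))
  have hon : Orthonormal 𝕜 u := ⟨fun n => (hu n).2.1, fun k n hkn => by
    rcases lt_or_gt_of_ne hkn with h | h
    · exact hinner k n h
    · exact inner_eq_zero_symm.1 (hinner n k h)⟩
  have hbot : (Submodule.span 𝕜 (Set.range u))ᗮ = ⊥ := by
    rw [Submodule.eq_bot_iff]
    intro z hz
    have hzu : ∀ n, inner 𝕜 (u n) z = 0 := fun n =>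
      (Submodule.mem_orthogonal _ _).1 hz _ (Submodule.subset_span ⟨n, rfl⟩)
    have hzd : ∀ k, inner 𝕜 z (d k) = 0 := by
      intro k
      let N : ℕ → ℕ := fun l => Nat.pair (Nat.pair k l) 0
      have hNinj : Function.Injective N := fun a b hab => by
        simpa [N, Nat.pair_eq_pair] using hab
      have hle : ∀ l, c * ‖inner 𝕜 z (d k)‖ ^ 2 ≤ ‖inner 𝕜 (u (N l)) (d k)‖ ^ 2 * ‖z‖ ^ 2 := by
        intro l
        have h1 := (hu (N l)).2.2.2 z (by
          rw [Submodule.mem_orthogonal]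
          intro y hy
          refine (Submodule.span_le.2 ?_ hy : y ∈ (Submodule.span 𝕜 {z})ᗮ) |>
            Submodule.mem_orthogonal_singleton_iff_inner_left.1
          rintro _ (⟨j, rfl⟩ | ⟨j, hj, rfl⟩)
          · exact Submodule.mem_orthogonal_singleton_iff_inner_left.2 (hzu j)
          · exfalso
            have hj2 := j.2
            simp only [Set.mem_ofPred_eq, N, Nat.unpair_pair] at hj
            have h3 := Nat.pair_unpair (j : ℕ)
            rw [hj] at h3
            rcases Nat.eq_zero_or_pos (Nat.unpair (j : ℕ)).2 with h0 | h0
            · rw [h0] at h3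
              exact hj2.ne h3.symm
            · have := Nat.pair_lt_pair_right (Nat.pair k l) h0
              rw [h3] at this
              exact absurd hj2 this.not_gt)
        simpa [N] using h1
      have hlim : Tendsto (fun l => ‖inner 𝕜 (u (N l)) (d k)‖ ^ 2 * ‖z‖ ^ 2) atTop (𝓝 0) := by
        have h1 := (hon.inner_products_summable (d k)).tendsto_atTop_zero
        have h2 := (h1.comp hNinj.nat_tendsto_atTop).mul_const (‖z‖ ^ 2)
        simpa using h2
      have h0 := ge_of_tendsto' hlim hle
      by_contra hne
      have : 0 < c * ‖inner 𝕜 z (d k)‖ ^ 2 := by positivity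
      linarith
    have hdense : DenseRange d := TopologicalSpace.denseRange_denseSeq K
    have : (fun y => inner 𝕜 z y) = fun _ : K => (0 : 𝕜) :=
      hdense.equalizer (by fun_prop) continuous_const (funext hzd)
    exact inner_self_eq_zero.1 (congrFun this z)
  have hbasis : Orthonormal 𝕜 (u ∘ Nat.pairEquiv) := hon.comp _ Nat.pairEquiv.injective
  refine ⟨HilbertBasis.mkOfOrthogonalEqBot hbasis (by
    rw [Set.range_comp, Nat.pairEquiv.range_eq_univ, Set.image_univ, hbot]), fun i => ?_⟩
  simp only [HilbertBasis.coe_mkOfOrthogonalEqBot]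
  refine ⟨fun j => (hu _).2.2.1, fun j k hjk => ?_⟩
  rcases lt_or_gt_of_ne hjk with h | h
  · exact hTinner _ _ (Nat.pair_lt_pair_right i h) (by simp)
  · exact inner_eq_zero_symm.1 (hTinner _ _ (Nat.pair_lt_pair_right i h) (by simp))

theorem Orthonormal.hasSum_starProjection {ι : Type*} {v : ι → H} (hv : Orthonormal 𝕜 v) (x : H) :
    HasSum (fun i => inner 𝕜 (v i) x • v i)
      ((Submodule.span 𝕜 (Set.range v)).topologicalClosure.starProjection x) := by
  set U := (Submodule.span 𝕜 (Set.range v)).topologicalClosure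
  have hvU : ∀ i, v i ∈ U := fun i =>
    Submodule.le_topologicalClosure _ (Submodule.subset_span ⟨i, rfl⟩)
  let w : ι → U := fun i => ⟨v i, hvU i⟩
  have hw : Orthonormal 𝕜 w := (U.subtypeₗᵢ.orthonormal_comp_iff (v := w)).1 hv
  have hbot : (Submodule.span 𝕜 (Set.range w))ᗮ = ⊥ := by
    rw [Submodule.eq_bot_iff]
    intro z hz
    have hzv : Submodule.span 𝕜 (Set.range v) ≤ (Submodule.span 𝕜 {(z : H)})ᗮ := by
      rw [Submodule.span_le]
      rintro _ ⟨i, rfl⟩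
      exact Submodule.mem_orthogonal_singleton_iff_inner_left.2
        ((Submodule.mem_orthogonal _ _).1 hz (w i) (Submodule.subset_span ⟨i, rfl⟩))
    have hzU := Submodule.topologicalClosure_minimal _ hzv (Submodule.isClosed_orthogonal _) z.2
    exact Subtype.ext (inner_self_eq_zero.1
      (Submodule.mem_orthogonal_singleton_iff_inner_left.1 hzU))
  have h := ((HilbertBasis.mkOfOrthogonalEqBot hw hbot).hasSum_orthogonalProjectionOnto x).mapL
    U.subtypeL
  simpa [w] using h

/-- The operator `T T†` is a strong sum of infinite-rank projections. -/
theorem exists_infinite_rank_projections_hasSum [TopologicalSpace.SeparableSpace K]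
    {T : K →L[𝕜] H} (hker : ¬ FiniteDimensional 𝕜 T.ker) {m : ℝ} (hm : 1 < m)
    (hT : ∀ F : Submodule 𝕜 K, FiniteDimensional 𝕜 F → ∃ x ∈ Fᗮ, ‖x‖ = 1 ∧ m ≤ ‖T x‖ ^ 2) :
    ∃ P : ℕ → (H →L[𝕜] H),
      (∀ i, IsSelfAdjoint (P i) ∧ (P i) ∘L (P i) = P i) ∧
      (∀ i, ¬ FiniteDimensional 𝕜 (LinearMap.range ((P i) : H →ₗ[𝕜] H))) ∧
      (∀ x : H, HasSum (fun i => P i x) (T (T.adjoint x))) := by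
  obtain ⟨u, hu⟩ := exists_hilbertBasis_orthonormal_blocks hker hm hT
  refine ⟨fun i => (Submodule.span 𝕜 (Set.range fun j =>
    T (u (i, j)))).topologicalClosure.starProjection, fun i =>
      ⟨isSelfAdjoint_starProjection _, Submodule.isIdempotentElem_starProjection _⟩,
      fun i hfin => ?_, fun x => ?_⟩
  · rw [Submodule.range_starProjection] at hfin
    have hli : LinearIndependent 𝕜 fun j => (⟨T (u (i, j)), Submodule.le_topologicalClosure _
        (Submodule.subset_span ⟨j, rfl⟩)⟩ : (Submodule.span 𝕜 (Set.range fun j =>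
          T (u (i, j)))).topologicalClosure) :=
      LinearIndependent.of_comp (Submodule.subtype _) (hu i).linearIndependent
    have := hli.finite
    exact not_finite ℕ
  · have h1 := (u.hasSum_repr (T.adjoint x)).mapL T
    refine h1.prod_fiberwise fun i => ?_
    simpa [u.repr_apply_apply, ContinuousLinearMap.adjoint_inner_right] using
      (hu i).hasSum_starProjection x

end

/-- A positive operator with `‖A‖ > 1` on an infinite-dimensional separable
Hilbert space, all of whose nonzero spectral projections have infinite rank, admits a
projection decomposition into infinite-rank self-adjoint projections.  The condition on
spectral projections is expressed equivalently: every eigenspace of `A` is either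
trivial or infinite-dimensional. -/
theorem projection_decomposition_of_nonatomic_positive
    {𝕜 H : Type*} [RCLike 𝕜] [NormedAddCommGroup H] [InnerProductSpace 𝕜 H]
    [CompleteSpace H] [TopologicalSpace.SeparableSpace H]
    (hinf : ¬ FiniteDimensional 𝕜 H)
    (A : H →L[𝕜] H) (hA : A.IsPositive) (hnorm : 1 < ‖A‖)
    (hspec : ∀ μ : 𝕜, Module.End.eigenspace (A : H →ₗ[𝕜] H) μ = ⊥ ∨
      ¬ FiniteDimensional 𝕜 (Module.End.eigenspace (A : H →ₗ[𝕜] H) μ)) :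
    ∃ (ι : Type) (_ : Countable ι) (P : ι → (H →L[𝕜] H)),
      (∀ i, IsSelfAdjoint (P i) ∧ (P i) ∘L (P i) = P i) ∧
      (∀ i, ¬ FiniteDimensional 𝕜 (LinearMap.range ((P i) : H →ₗ[𝕜] H))) ∧
      (∀ x : H, HasSum (fun i => P i x) (A x)) := by
  have hA0 : A ≠ 0 := fun h => by simp [h] at hnorm; linarith
  obtain ⟨S, hS, hSS⟩ := hA.exists_isSelfAdjoint_mul_self_eq
  have hSx : ∀ x, ‖S x‖ ^ 2 = RCLike.re (inner 𝕜 (A x) x) := fun x => by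
    rw [← hSS, mul_apply_eq_comp, ← ContinuousLinearMap.adjoint_inner_right,
      hS.adjoint_eq, inner_self_eq_norm_sq]
  let T : WithLp 2 (H × H) →L[𝕜] H := S ∘L WithLp.fstL 2 𝕜 H H
  have hT : ∀ p, T p = S p.fst := fun p => rfl
  have hTadj : ∀ x, T.adjoint x = WithLp.toLp 2 (S x, 0) := fun x =>
    ext_inner_right 𝕜 fun p => by
      rw [ContinuousLinearMap.adjoint_inner_left, hT, ← ContinuousLinearMap.adjoint_inner_left,
        hS.adjoint_eq, WithLp.prod_inner_apply]
      simp
  have hker : ¬ FiniteDimensional 𝕜 T.ker := by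
    intro hfin
    let f : H →ₗ[𝕜] T.ker := LinearMap.codRestrict _
      ((WithLp.linearEquiv 2 𝕜 (H × H)).symm.toLinearMap ∘ₗ LinearMap.inr 𝕜 H H)
      fun x => by simp [hT]
    refine hinf (FiniteDimensional.of_injective f fun x y hxy => ?_)
    have := congrArg (fun p : T.ker => (p : WithLp 2 (H × H)).snd) hxy
    simpa [f] using this
  obtain ⟨m, hm1, hm⟩ := exists_between hnorm
  obtain ⟨P, hP, hPinf, hPsum⟩ := exists_infinite_rank_projections_hasSum hker hm1 (T := T)
    fun F _ => by
      obtain ⟨x, hxF, hx1, hx⟩ := hA.exists_mem_orthogonal_lt_re_inner hA0 (hspec _)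
        (F.map (WithLp.fstL 2 𝕜 H H).toLinearMap) hm
      refine ⟨WithLp.toLp 2 (x, 0), ?_, ?_, ?_⟩
      · rw [Submodule.mem_orthogonal]
        intro y hy
        rw [WithLp.prod_inner_apply]
        simpa using (Submodule.mem_orthogonal _ _).1 hxF _ (Submodule.mem_map_of_mem hy)
      · simpa using hx1
      · rw [hT, hSx]
        exact hx.le
  refine ⟨ℕ, inferInstance, P, hP, hPinf, fun x => ?_⟩
  have h := hPsum x
  rw [hTadj, hT] at h
  rwa [← hSS]
end

section
/- Let A be a positive operator on an infinite-dimensional separable Hilbert space with ‖A‖_ess > 1. Then A admits a projection decomposition: A = ∑_i P_i with each P_i a self-adjoint projection and convergence in the strong operator topology. -/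
/-- The essential norm of a bounded operator: its distance to the compact operators. -/
noncomputable def essNorm {𝕜 H : Type*} [RCLike 𝕜] [NormedAddCommGroup H]
    [InnerProductSpace 𝕜 H] (A : H →L[𝕜] H) : ℝ :=
  sInf {c : ℝ | ∃ K : H →L[𝕜] H, IsCompactOperator (⇑K) ∧ c = ‖A - K‖}

universe u

section UnitFamilies

variable {𝕜 K H : Type*} [RCLike 𝕜] [NormedAddCommGroup K] [InnerProductSpace 𝕜 K]
  [NormedAddCommGroup H] [InnerProductSpace 𝕜 H]

theorem norm_sq_real_smul_add_real_smul_of_inner_eq_zero {f g : K} (h : inner 𝕜 f g = 0)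
    (c s : ℝ) :
    ‖(c : 𝕜) • f + (s : 𝕜) • g‖ ^ 2 = c ^ 2 * ‖f‖ ^ 2 + s ^ 2 * ‖g‖ ^ 2 := by
  rw [@norm_add_sq 𝕜]
  simp [inner_smul_left, inner_smul_right, h, norm_smul, mul_pow]

/-- A finite orthonormal set each of whose members is mapped to a unit vector by `T`. -/
structure IsUnitPreservingFamily (T : K →L[𝕜] H) (s : Set K) : Prop where
  finite : s.Finite
  norm_eq_one : ∀ v ∈ s, ‖v‖ = 1
  norm_map_eq_one : ∀ v ∈ s, ‖T v‖ = 1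
  pairwise_orthogonal : s.Pairwise fun v w => inner 𝕜 v w = 0

theorem IsUnitPreservingFamily.empty (T : K →L[𝕜] H) : IsUnitPreservingFamily T ∅ :=
  ⟨Set.finite_empty, by simp, by simp, by simp⟩

theorem IsUnitPreservingFamily.insert {T : K →L[𝕜] H} {s : Set K}
    (hs : IsUnitPreservingFamily T s) {e : K} (he : ‖e‖ = 1) (hTe : ‖T e‖ = 1)
    (hes : ∀ v ∈ s, inner 𝕜 v e = 0) : IsUnitPreservingFamily T (insert e s) where
  finite := hs.finite.insert e
  norm_eq_one := by
    rintro v (rfl | hv)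
    exacts [he, hs.norm_eq_one v hv]
  norm_map_eq_one := by
    rintro v (rfl | hv)
    exacts [hTe, hs.norm_map_eq_one v hv]
  pairwise_orthogonal := hs.pairwise_orthogonal.insert fun v hv _ =>
    ⟨inner_eq_zero_symm.1 (hes v hv), hes v hv⟩

theorem IsUnitPreservingFamily.orthonormal {T : K →L[𝕜] H} {s : Set K}
    (hs : IsUnitPreservingFamily T s) : Orthonormal 𝕜 ((↑) : s → K) :=
  ⟨fun v => hs.norm_eq_one v v.2, fun v w hvw =>
    hs.pairwise_orthogonal v.2 w.2 (Subtype.coe_ne_coe.2 hvw)⟩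

/-- Two orthogonal unit vectors whose images are orthogonal can be rotated inside their span so
that the image of the first one becomes a unit vector. -/
theorem exists_rotation_norm_map_eq_one (T : K →L[𝕜] H) {f g : K} (hf : ‖f‖ = 1) (hg : ‖g‖ = 1)
    (hfg : inner 𝕜 f g = 0) (hTfg : inner 𝕜 (T f) (T g) = 0)
    (hab : (‖T f‖ ^ 2 - 1) * (‖T g‖ ^ 2 - 1) ≤ 0) :
    ∃ e f' : K, ‖e‖ = 1 ∧ ‖f'‖ = 1 ∧ inner 𝕜 e f' = 0 ∧ ‖T e‖ = 1 ∧
      ‖T f'‖ ^ 2 = ‖T f‖ ^ 2 + ‖T g‖ ^ 2 - 1 ∧ e ∈ Submodule.span 𝕜 {f, g} ∧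
      f' ∈ Submodule.span 𝕜 {f, g} ∧ f ∈ Submodule.span 𝕜 {e, f'} := by
  obtain ⟨c, s, hcs, hcs'⟩ : ∃ c s : ℝ, c ^ 2 + s ^ 2 = 1 ∧
      c ^ 2 * ‖T f‖ ^ 2 + s ^ 2 * ‖T g‖ ^ 2 = 1 := by
    generalize ‖T f‖ ^ 2 = a at hab ⊢
    generalize ‖T g‖ ^ 2 = b at hab ⊢
    by_cases h : a = b
    · subst h
      have : a = 1 := by nlinarith
      exact ⟨1, 0, by simp, by simp [this]⟩
    · have hsub : a - b ≠ 0 := sub_ne_zero.2 h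
      have h1 : 0 ≤ (1 - b) / (a - b) := by
        rcases lt_or_gt_of_ne h with h | h
        · exact div_nonneg_of_nonpos (by nlinarith) (by linarith)
        · exact div_nonneg (by nlinarith) (by linarith)
      have h2 : 0 ≤ (a - 1) / (a - b) := by
        rcases lt_or_gt_of_ne h with h | h
        · exact div_nonneg_of_nonpos (by nlinarith) (by linarith)
        · exact div_nonneg (by nlinarith) (by linarith)
      refine ⟨√((1 - b) / (a - b)), √((a - 1) / (a - b)), ?_, ?_⟩ <;>
      · rw [Real.sq_sqrt h1, Real.sq_sqrt h2]
        field_simp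
        ring
  have mem (x y : 𝕜) (u v : K) : x • u + y • v ∈ Submodule.span 𝕜 {u, v} :=
    Submodule.mem_span_pair.2 ⟨x, y, rfl⟩
  have one_of_sq {r : ℝ} (hr : 0 ≤ r) (h : r ^ 2 = 1) : r = 1 := by nlinarith
  have hcs𝕜 : (c : 𝕜) ^ 2 + (s : 𝕜) ^ 2 = 1 := by exact_mod_cast hcs
  refine ⟨(c : 𝕜) • f + (s : 𝕜) • g, ((-s : ℝ) : 𝕜) • f + (c : 𝕜) • g,
    one_of_sq (norm_nonneg _) ?_, one_of_sq (norm_nonneg _) ?_, ?_,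
    one_of_sq (norm_nonneg _) ?_, ?_, mem _ _ _ _, mem _ _ _ _, ?_⟩
  · rw [norm_sq_real_smul_add_real_smul_of_inner_eq_zero hfg, hf, hg]
    linarith
  · rw [norm_sq_real_smul_add_real_smul_of_inner_eq_zero hfg, hf, hg]
    linarith
  · simp [inner_add_left, inner_add_right, inner_smul_left, inner_smul_right, hfg,
      inner_eq_zero_symm.1 hfg, inner_self_eq_norm_sq_to_K, hf, hg]
    ring
  · rw [map_add, map_smul, map_smul, norm_sq_real_smul_add_real_smul_of_inner_eq_zero hTfg, hcs']
  · rw [map_add, map_smul, map_smul, norm_sq_real_smul_add_real_smul_of_inner_eq_zero hTfg]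
    linear_combination (‖T f‖ ^ 2 + ‖T g‖ ^ 2) * hcs - hcs'
  · refine Submodule.mem_span_pair.2 ⟨c, ((-s : ℝ) : 𝕜), ?_⟩
    calc (c : 𝕜) • ((c : 𝕜) • f + (s : 𝕜) • g) +
          ((-s : ℝ) : 𝕜) • (((-s : ℝ) : 𝕜) • f + (c : 𝕜) • g)
        = ((c : 𝕜) ^ 2 + (s : 𝕜) ^ 2) • f := by push_cast; module
      _ = f := by rw [hcs𝕜, one_smul]

/-- If `T` vanishes on unit vectors, and is large on unit vectors, orthogonal to any given
finite-dimensional subspace, then all intermediate values are attained there. -/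
theorem exists_unit_mem_orthogonal_norm_map_sq_eq (T : K →L[𝕜] H) {M : ℝ}
    (hker : ∀ F : Submodule 𝕜 K, FiniteDimensional 𝕜 F → ∃ u ∈ Fᗮ, ‖u‖ = 1 ∧ T u = 0)
    (hlarge : ∀ F : Submodule 𝕜 K, FiniteDimensional 𝕜 F →
      ∃ v ∈ Fᗮ, ‖v‖ = 1 ∧ M ≤ ‖T v‖ ^ 2)
    (F : Submodule 𝕜 K) [FiniteDimensional 𝕜 F] {b : ℝ} (hb : 0 ≤ b) (hbM : b ≤ M) :
    ∃ g ∈ Fᗮ, ‖g‖ = 1 ∧ ‖T g‖ ^ 2 = b := by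
  obtain ⟨v, hvF, hv, hTv⟩ := hlarge F inferInstance
  obtain ⟨u, huF, hu, hTu⟩ := hker (F ⊔ Submodule.span 𝕜 {v}) inferInstance
  rw [← Submodule.inf_orthogonal, Submodule.mem_inf,
    Submodule.mem_orthogonal_singleton_iff_inner_right] at huF
  obtain ⟨s, hs, hsb⟩ : ∃ s : ℝ, s ^ 2 ≤ 1 ∧ s ^ 2 * ‖T v‖ ^ 2 = b := by
    rcases hb.eq_or_lt with rfl | hb0
    · exact ⟨0, by simp, by simp⟩
    · have hpos : 0 < ‖T v‖ ^ 2 := by linarith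
      refine ⟨√(b / ‖T v‖ ^ 2), ?_, ?_⟩ <;> rw [Real.sq_sqrt (by positivity)]
      · exact (div_le_one hpos).2 (hbM.trans hTv)
      · exact div_mul_cancel₀ _ hpos.ne'
  refine ⟨(s : 𝕜) • v + (√(1 - s ^ 2) : 𝕜) • u,
    add_mem (Submodule.smul_mem _ _ hvF) (Submodule.smul_mem _ _ huF.1), ?_, ?_⟩
  · have := norm_sq_real_smul_add_real_smul_of_inner_eq_zero huF.2 s √(1 - s ^ 2)
    rw [Real.sq_sqrt (by linarith), hv, hu] at this
    nlinarith [norm_nonneg ((s : 𝕜) • v + (√(1 - s ^ 2) : 𝕜) • u)]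
  · simp [hTu, norm_smul, mul_pow, hsb]

variable [CompleteSpace K] [CompleteSpace H]

theorem IsUnitPreservingFamily.exists_superset_mem_span_of_unit {T : K →L[𝕜] H} {δ : ℝ}
    (hδ : 0 ≤ δ)
    (hT : ∀ F : Submodule 𝕜 K, FiniteDimensional 𝕜 F → ∀ b ∈ Set.Icc (1 - δ) (1 + δ),
      ∃ g ∈ Fᗮ, ‖g‖ = 1 ∧ ‖T g‖ ^ 2 = b) (n : ℕ) :
    ∀ (s : Set K) (_ : IsUnitPreservingFamily T s) (f : K) (_ : ‖f‖ = 1)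
      (_ : ∀ v ∈ s, inner 𝕜 v f = 0) (_ : |‖T f‖ ^ 2 - 1| ≤ n * δ),
      ∃ s', IsUnitPreservingFamily T s' ∧ s ⊆ s' ∧ f ∈ Submodule.span 𝕜 s' := by
  induction n with
  | zero =>
    intro s hs f hf hsf ha
    have hTf : ‖T f‖ ^ 2 = 1 := by
      rw [Nat.cast_zero, zero_mul] at ha
      linarith [abs_nonpos_iff.1 ha]
    exact ⟨_, hs.insert hf (by nlinarith [norm_nonneg (T f)]) hsf, Set.subset_insert _ _,
      Submodule.subset_span (Set.mem_insert _ _)⟩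
  | succ n ih =>
    intro s hs f hf hsf ha
    obtain ⟨b, hb, hab, ha'⟩ : ∃ b ∈ Set.Icc (1 - δ) (1 + δ), (‖T f‖ ^ 2 - 1) * (b - 1) ≤ 0 ∧
        |‖T f‖ ^ 2 + b - 1 - 1| ≤ n * δ := by
      generalize ‖T f‖ ^ 2 = a at ha ⊢
      push_cast at ha
      have hnδ : 0 ≤ n * δ := by positivity
      obtain ⟨h1, h2⟩ := abs_le.1 ha
      rcases le_total 1 a with h | h
      · rcases le_total (a - 1) δ with h' | h'
        · exact ⟨2 - a, ⟨by linarith, by linarith⟩, by nlinarith,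
            abs_le.2 ⟨by linarith, by linarith⟩⟩
        · exact ⟨1 - δ, ⟨by linarith, by linarith⟩, by nlinarith,
            abs_le.2 ⟨by linarith, by linarith⟩⟩
      · rcases le_total (1 - a) δ with h' | h'
        · exact ⟨2 - a, ⟨by linarith, by linarith⟩, by nlinarith,
            abs_le.2 ⟨by linarith, by linarith⟩⟩
        · exact ⟨1 + δ, ⟨by linarith, by linarith⟩, by nlinarith,
            abs_le.2 ⟨by linarith, by linarith⟩⟩
    obtain ⟨g, hgF, hg, hTg⟩ := hT (Submodule.span 𝕜 (s ∪ {f, T.adjoint (T f)}))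
      (FiniteDimensional.span_of_finite 𝕜 (hs.finite.union (Set.toFinite _))) b hb
    have horth (v : K) (hv : v ∈ s ∪ {f, T.adjoint (T f)}) : inner 𝕜 v g = 0 :=
      (Submodule.mem_orthogonal _ _).1 hgF v (Submodule.subset_span hv)
    obtain ⟨e, f', he, hf', hef', hTe, hTf', heS, hf'S, hfS⟩ :=
      exists_rotation_norm_map_eq_one T hf hg (horth f (by simp))
        (by rw [← ContinuousLinearMap.adjoint_inner_left]; exact horth _ (by simp))
        (by rwa [hTg])
    have hperp (v : K) (hv : v ∈ s) (x : K) (hx : x ∈ Submodule.span 𝕜 {f, g}) :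
        inner 𝕜 v x = 0 := by
      obtain ⟨p, q, rfl⟩ := Submodule.mem_span_pair.1 hx
      simp [inner_add_right, inner_smul_right, hsf v hv, horth v (Or.inl hv)]
    obtain ⟨s', hs', hsub, hmem⟩ := ih _ (hs.insert he hTe fun v hv => hperp v hv e heS) f' hf'
      (by
        rintro v (rfl | hv)
        exacts [hef', hperp v hv f' hf'S])
      (by rwa [hTf', hTg])
    refine ⟨s', hs', (Set.subset_insert _ _).trans hsub, ?_⟩
    refine (Submodule.span_le.2 ?_) hfS
    rintro x (rfl | rfl)
    exacts [Submodule.subset_span (hsub (Set.mem_insert _ _)), hmem]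

theorem IsUnitPreservingFamily.exists_superset_mem_span {T : K →L[𝕜] H} {s : Set K}
    (hs : IsUnitPreservingFamily T s) {δ : ℝ} (hδ : 0 < δ)
    (hT : ∀ F : Submodule 𝕜 K, FiniteDimensional 𝕜 F → ∀ b ∈ Set.Icc (1 - δ) (1 + δ),
      ∃ g ∈ Fᗮ, ‖g‖ = 1 ∧ ‖T g‖ ^ 2 = b) (f : K) :
    ∃ s', IsUnitPreservingFamily T s' ∧ s ⊆ s' ∧ f ∈ Submodule.span 𝕜 s' := by
  have : FiniteDimensional 𝕜 (Submodule.span 𝕜 s) := FiniteDimensional.span_of_finite 𝕜 hs.finite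
  obtain ⟨y, hy, z, hz, rfl⟩ := (Submodule.span 𝕜 s).exists_add_mem_mem_orthogonal f
  by_cases hz0 : z = 0
  · exact ⟨s, hs, subset_rfl, by simpa [hz0] using hy⟩
  obtain ⟨n, hn⟩ := exists_nat_ge (|‖T ((‖z‖⁻¹ : 𝕜) • z)‖ ^ 2 - 1| / δ)
  obtain ⟨s', hs', hsub, hmem⟩ := exists_superset_mem_span_of_unit hδ.le hT n s hs
    ((‖z‖⁻¹ : 𝕜) • z) (norm_smul_inv_norm hz0)
    (fun v hv => by
      rw [inner_smul_right, (Submodule.mem_orthogonal _ _).1 hz v (Submodule.subset_span hv),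
        mul_zero])
    ((div_le_iff₀ hδ).1 hn)
  refine ⟨s', hs', hsub, add_mem (Submodule.span_mono hsub hy) ?_⟩
  have hne : (‖z‖ : 𝕜) ≠ 0 := by simpa using hz0
  simpa [smul_smul, hne] using Submodule.smul_mem _ (‖z‖ : 𝕜) hmem

theorem exists_countable_orthonormal_norm_map_eq_one (T : K →L[𝕜] H) {δ : ℝ} (hδ : 0 < δ)
    (hT : ∀ F : Submodule 𝕜 K, FiniteDimensional 𝕜 F → ∀ b ∈ Set.Icc (1 - δ) (1 + δ),
      ∃ g ∈ Fᗮ, ‖g‖ = 1 ∧ ‖T g‖ ^ 2 = b) (f : ℕ → K) :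
    ∃ s : Set K, s.Countable ∧ Orthonormal 𝕜 ((↑) : s → K) ∧ (∀ v ∈ s, ‖T v‖ = 1) ∧
      ∀ n, f n ∈ Submodule.span 𝕜 s := by
  choose next hnext hsub hmem using
    fun (s : {s : Set K // IsUnitPreservingFamily T s}) x =>
      s.2.exists_superset_mem_span hδ hT x
  let S : ℕ → {s : Set K // IsUnitPreservingFamily T s} :=
    Nat.rec ⟨∅, .empty T⟩ fun n s => ⟨next s (f n), hnext s (f n)⟩
  have hmono : Monotone fun n => (S n).1 := monotone_nat_of_le_succ fun n => hsub (S n) (f n)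
  refine ⟨⋃ n, (S n).1, Set.countable_iUnion fun n => (S n).2.finite.countable,
    orthonormal_iUnion_of_directed hmono.directed_le fun n => (S n).2.orthonormal, ?_, fun n => ?_⟩
  · simp only [Set.mem_iUnion]
    rintro v ⟨n, hv⟩
    exact (S n).2.norm_map_eq_one v hv
  · exact Submodule.span_mono (Set.subset_iUnion (fun n => (S n).1) (n + 1))
      (hmem (S n) (f n))

end UnitFamilies

theorem Orthonormal.hasSum_inner_smul_of_mem_closure_span {𝕜 K : Type*} [RCLike 𝕜]
    [NormedAddCommGroup K] [InnerProductSpace 𝕜 K] [CompleteSpace K] {s : Set K}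
    (hs : Orthonormal 𝕜 ((↑) : s → K)) {x : K}
    (hx : x ∈ (Submodule.span 𝕜 s).topologicalClosure) :
    HasSum (fun v : s => inner 𝕜 (v : K) x • (v : K)) x := by
  obtain ⟨w, b, hsw, hb⟩ := hs.exists_hilbertBasis_extension
  have hsum := b.hasSum_repr x
  simp only [b.repr_apply_apply, hb] at hsum
  have hw : Orthonormal 𝕜 ((↑) : w → K) := hb ▸ b.orthonormal
  have hzero (v : w) (hv : (v : K) ∉ s) : inner 𝕜 (v : K) x = 0 := by
    have hle : (Submodule.span 𝕜 s).topologicalClosure ≤ (Submodule.span 𝕜 {(v : K)})ᗮ := by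
      refine Submodule.topologicalClosure_minimal _ (Submodule.span_le.2 fun u hu => ?_)
        (Submodule.isClosed_orthogonal _)
      rw [SetLike.mem_coe, Submodule.mem_orthogonal_singleton_iff_inner_right]
      exact hw.2 (i := v) (j := ⟨u, hsw hu⟩) fun h => hv (h ▸ hu)
    exact Submodule.mem_orthogonal_singleton_iff_inner_right.1 (hle hx)
  refine ((Set.inclusion_injective hsw).hasSum_iff fun v hv => ?_).2 hsum
  rw [hzero v fun hvs => hv ⟨⟨v, hvs⟩, rfl⟩, zero_smul]

/-- Every positive semidefinite sesquilinear form is the pullback of the inner product of a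
Hilbert space along a linear map. -/
theorem PreInnerProductSpace.Core.exists_linearMap_inner_eq {𝕜 : Type*} {V : Type u} [RCLike 𝕜]
    [AddCommGroup V] [Module 𝕜 V] (c : PreInnerProductSpace.Core 𝕜 V) :
    ∃ (K : Type u) (_ : NormedAddCommGroup K) (_ : InnerProductSpace 𝕜 K) (_ : CompleteSpace K)
      (J : V →ₗ[𝕜] K), ∀ x y, inner 𝕜 (J x) (J y) = c.inner x y := by
  let : SeminormedAddCommGroup V := InnerProductSpace.Core.toSeminormedAddCommGroup (𝕜 := 𝕜)
  let : InnerProductSpace 𝕜 V := InnerProductSpace.ofCore c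
  exact ⟨UniformSpace.Completion V, inferInstance, inferInstance, inferInstance,
    (UniformSpace.Completion.toComplL : V →L[𝕜] UniformSpace.Completion V).toLinearMap,
    fun x y => UniformSpace.Completion.inner_coe x y⟩

section Factorization

variable {𝕜 : Type*} {H : Type u} [RCLike 𝕜] [NormedAddCommGroup H] [InnerProductSpace 𝕜 H]

/-- A positive operator factors as `J† ∘ J` through a Hilbert space containing an isometric copy
of `H` orthogonal to the range of `J`. -/
theorem ContinuousLinearMap.IsPositive.exists_factorization {A : H →L[𝕜] H} (hA : A.IsPositive) :
    ∃ (K : Type u) (_ : NormedAddCommGroup K) (_ : InnerProductSpace 𝕜 K) (_ : CompleteSpace K)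
      (J : H →L[𝕜] K) (L : H →ₗ[𝕜] K), (∀ x y, inner 𝕜 (J x) (J y) = inner 𝕜 (A x) y) ∧
      (∀ x y, inner 𝕜 (L x) (L y) = inner 𝕜 x y) ∧ ∀ x y, inner 𝕜 (L x) (J y) = 0 := by
  let c : PreInnerProductSpace.Core 𝕜 (H × H) :=
    { inner x y := inner 𝕜 (A x.1) y.1 + inner 𝕜 x.2 y.2
      conj_inner_symm x y := by
        simp [hA.inner_left_eq_inner_right]
      re_inner_nonneg x := by
        simpa using add_nonneg (hA.re_inner_nonneg_left x.1) (inner_self_nonneg (𝕜 := 𝕜))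
      add_left x y z := by
        simp only [Prod.fst_add, Prod.snd_add, map_add, inner_add_left]
        ring
      smul_left x y r := by
        simp only [Prod.smul_fst, Prod.smul_snd, map_smul, inner_smul_left]
        ring }
  obtain ⟨K, _, _, _, J, hJ⟩ := c.exists_linearMap_inner_eq
  have hinner (x y : H × H) : inner 𝕜 (J x) (J y) = inner 𝕜 (A x.1) y.1 + inner 𝕜 x.2 y.2 :=
    hJ x y
  refine ⟨K, ‹_›, ‹_›, ‹_›, (J ∘ₗ LinearMap.inl 𝕜 H H).mkContinuous √‖A‖ fun x => ?_,
    J ∘ₗ LinearMap.inr 𝕜 H H, ?_, ?_, ?_⟩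
  · refine abs_le_of_sq_le_sq' ?_ (by positivity) |>.2
    rw [mul_pow, Real.sq_sqrt (norm_nonneg _), ← inner_self_eq_norm_sq (𝕜 := 𝕜), LinearMap.comp_apply, LinearMap.inl_apply]
    calc RCLike.re (inner 𝕜 (J (x, 0)) (J (x, 0))) = RCLike.re (inner 𝕜 (A x) x) := by
          rw [hinner]
          simp
      _ ≤ ‖A x‖ * ‖x‖ := re_inner_le_norm _ _
      _ ≤ ‖A‖ * ‖x‖ * ‖x‖ := by gcongr; exact A.le_opNorm x
      _ = ‖A‖ * ‖x‖ ^ 2 := by ring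
  all_goals simp [hinner]

theorem essNorm_le_norm_sub (A : H →L[𝕜] H) {C : H →L[𝕜] H} (hC : IsCompactOperator C) :
    essNorm A ≤ ‖A - C‖ :=
  csInf_le ⟨0, by rintro _ ⟨C, _, rfl⟩; exact norm_nonneg _⟩ ⟨C, hC, rfl⟩

variable {K : Type*} [NormedAddCommGroup K] [InnerProductSpace 𝕜 K] [CompleteSpace K]
  [CompleteSpace H]

theorem exists_unit_mem_orthogonal_le_norm_map_sq (T : K →L[𝕜] H) {M : ℝ} (hM : 0 ≤ M)
    (hess : M < essNorm (T ∘L T.adjoint)) (F : Submodule 𝕜 K) [FiniteDimensional 𝕜 F] :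
    ∃ v ∈ Fᗮ, ‖v‖ = 1 ∧ M ≤ ‖T v‖ ^ 2 := by
  by_contra! hcon
  have hle (v : K) (hv : v ∈ Fᗮ) : ‖T v‖ ≤ √M * ‖v‖ := by
    rcases eq_or_ne v 0 with rfl | hv0
    · simp
    have h := hcon ((‖v‖⁻¹ : 𝕜) • v) (Submodule.smul_mem _ _ hv) (norm_smul_inv_norm hv0)
    rw [map_smul, norm_smul, norm_inv, RCLike.norm_ofReal, abs_norm, inv_mul_eq_div] at h
    exact (div_le_iff₀ (norm_pos_iff.2 hv0)).1 (Real.le_sqrt_of_sq_le h.le)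
  let Q := Fᗮ.starProjection
  have hTQ : ‖T ∘L Q‖ ≤ √M :=
    ContinuousLinearMap.opNorm_le_bound _ (Real.sqrt_nonneg _) fun x =>
      (hle _ (Submodule.starProjection_apply_mem _ _)).trans
        (mul_le_mul_of_nonneg_left (Submodule.norm_starProjection_apply_le _ _)
          (Real.sqrt_nonneg _))
  have hadj : (T ∘L Q).adjoint = Q ∘L T.adjoint := by
    rw [ContinuousLinearMap.adjoint_comp]
    congr 1
    exact (isSelfAdjoint_starProjection Fᗮ)
  have hcompact : IsCompactOperator (T ∘L F.starProjection ∘L T.adjoint) := by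
    have : ProperSpace F := FiniteDimensional.proper 𝕜 F
    exact (isCompactOperator_of_locallyCompactSpace_rng
      (T ∘L F.subtypeL)).comp_clm (F.orthogonalProjectionOnto ∘L T.adjoint)
  have heq : T ∘L T.adjoint - T ∘L F.starProjection ∘L T.adjoint =
      (T ∘L Q) ∘L (T ∘L Q).adjoint := by
    rw [hadj]
    ext x
    have hidem (y : K) : F.starProjection (F.starProjection y) = F.starProjection y :=
      Submodule.starProjection_eq_self_iff.2 (Submodule.starProjection_apply_mem _ _)
    simp [Q, hidem]
  have := essNorm_le_norm_sub (T ∘L T.adjoint) hcompact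
  rw [heq] at this
  have h2 := ContinuousLinearMap.opNorm_comp_le (T ∘L Q) (T ∘L Q).adjoint
  rw [LinearIsometryEquiv.norm_map] at h2
  linarith [mul_self_le_mul_self (norm_nonneg (T ∘L Q)) hTQ, Real.mul_self_sqrt hM]

end Factorization

theorem LinearMap.exists_ne_zero_map_mem_orthogonal {𝕜 H K : Type*} [RCLike 𝕜]
    [AddCommGroup H] [Module 𝕜 H] [NormedAddCommGroup K] [InnerProductSpace 𝕜 K]
    (hinf : ¬ FiniteDimensional 𝕜 H) (L : H →ₗ[𝕜] K) (F : Submodule 𝕜 K)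
    [FiniteDimensional 𝕜 F] : ∃ h ≠ 0, L h ∈ Fᗮ := by
  by_contra! hcon
  refine hinf (FiniteDimensional.of_injective
    (F.orthogonalProjectionOnto.toLinearMap ∘ₗ L) ((injective_iff_map_eq_zero _).2 fun h hh => ?_))
  by_contra h0
  exact hcon h h0 (Submodule.orthogonalProjectionOnto_eq_zero_iff.1 hh)

/-- Every positive operator with essential norm `> 1` on an
infinite-dimensional separable Hilbert space admits a projection decomposition:
a strongly convergent sum of self-adjoint projections. -/
theorem projection_decomposition_of_essNorm_gt_one
    {𝕜 H : Type*} [RCLike 𝕜] [NormedAddCommGroup H] [InnerProductSpace 𝕜 H]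
    [CompleteSpace H] [TopologicalSpace.SeparableSpace H]
    (hinf : ¬ FiniteDimensional 𝕜 H)
    (A : H →L[𝕜] H) (hA : A.IsPositive) (hess : 1 < essNorm A) :
    ∃ (ι : Type) (_ : Countable ι) (P : ι → (H →L[𝕜] H)),
      (∀ i, IsSelfAdjoint (P i) ∧ (P i) ∘L (P i) = P i) ∧
      (∀ x : H, HasSum (fun i => P i x) (A x)) := by
  obtain ⟨K, _, _, _, J, L, hJ, hL, hLJ⟩ := hA.exists_factorization
  have hTJ : J.adjoint ∘L J = A := by
    ext x
    refine ext_inner_right 𝕜 fun y => ?_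
    rw [ContinuousLinearMap.comp_apply, ContinuousLinearMap.adjoint_inner_left, hJ]
  have hTL (h : H) : J.adjoint (L h) = 0 :=
    ext_inner_right 𝕜 fun y => by
      rw [ContinuousLinearMap.adjoint_inner_left, hLJ, inner_zero_left]
  obtain ⟨M, hM1, hM⟩ := exists_between hess
  have hker (F : Submodule 𝕜 K) (_ : FiniteDimensional 𝕜 F) :
      ∃ u ∈ Fᗮ, ‖u‖ = 1 ∧ J.adjoint u = 0 := by
    obtain ⟨h, h0, hF⟩ := L.exists_ne_zero_map_mem_orthogonal hinf F
    have hLh : L h ≠ 0 := fun h' => h0 (by simpa [h'] using (hL h h).symm)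
    exact ⟨(‖L h‖⁻¹ : 𝕜) • L h, Submodule.smul_mem _ _ hF, norm_smul_inv_norm hLh,
      by rw [map_smul, hTL, smul_zero]⟩
  obtain ⟨δ, hδ, hδ1, hδM⟩ : ∃ δ : ℝ, 0 < δ ∧ δ ≤ 1 ∧ 1 + δ ≤ M :=
    ⟨min 1 (M - 1), lt_min one_pos (by linarith), min_le_left _ _,
      by linarith [min_le_right 1 (M - 1)]⟩
  obtain ⟨s, hs, hso, hsT, hspan⟩ := exists_countable_orthonormal_norm_map_eq_one J.adjoint hδ
    (fun F _ b hb => exists_unit_mem_orthogonal_norm_map_sq_eq J.adjoint hker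
      (fun F _ => exists_unit_mem_orthogonal_le_norm_map_sq J.adjoint (by linarith)
        (by rwa [ContinuousLinearMap.adjoint_adjoint, hTJ]) F) F
      (by linarith [hb.1]) (hb.2.trans hδM))
    (fun n => J (TopologicalSpace.denseSeq H n))
  have hrange (x : H) : J x ∈ (Submodule.span 𝕜 s).topologicalClosure := by
    have hmaps : Set.MapsTo J (Set.range (TopologicalSpace.denseSeq H))
        (Submodule.span 𝕜 s : Set K) := by
      rintro _ ⟨n, rfl⟩
      exact hspan n
    exact hmaps.closure J.continuous (TopologicalSpace.denseRange_denseSeq H x)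
  have := hs.to_subtype
  obtain ⟨φ, hφ⟩ := exists_injective_nat s
  let eqv := Equiv.ofInjective φ hφ
  refine ⟨Set.range φ, inferInstance, fun i =>
    InnerProductSpace.rankOne 𝕜 (J.adjoint (eqv.symm i : s)) (J.adjoint (eqv.symm i : s)),
    fun i => ?_, fun x => ?_⟩
  · have hproj := InnerProductSpace.isStarProjection_rankOne_self (𝕜 := 𝕜)
      (hsT _ (eqv.symm i).2)
    exact ⟨hproj.isSelfAdjoint, hproj.isIdempotentElem⟩
  · have hsum := (hso.hasSum_inner_smul_of_mem_closure_span (hrange x)).mapL J.adjoint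
    rw [← ContinuousLinearMap.comp_apply, hTJ] at hsum
    convert! eqv.symm.hasSum_iff.2 hsum using 2 with i
    simp [ContinuousLinearMap.adjoint_inner_left]
end

section
/- Let A be an invertible bounded operator on a separable Hilbert space H and let S be the unit sphere of H. Then there exists a unique positive invertible operator T such that T(S) = A(S); namely T = (AA*)^{1/2}. -/
open scoped InnerProductSpace

section PositiveSquareRoot

variable {𝕜 H : Type*} [RCLike 𝕜] [NormedAddCommGroup H] [InnerProductSpace 𝕜 H]

theorem ContinuousLinearMap.IsPositive.norm_apply_sq_le_s19 {S : H →L[𝕜] H} (hS : S.IsPositive)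
    {t : ℝ} (ht : 0 < t) (hSt : ‖S‖ ≤ t) (x : H) :
    ‖S x‖ ^ 2 ≤ t * RCLike.re ⟪S x, x⟫_𝕜 := by
  have h0 := hS.re_inner_nonneg_left ((t : 𝕜) • x - S x)
  have h1 : ⟪S (S x), x⟫_𝕜 = ⟪S x, S x⟫_𝕜 := hS.isSymmetric (S x) x
  have h2 : RCLike.re ⟪S (S x), S x⟫_𝕜 ≤ t * ‖S x‖ ^ 2 :=
    calc RCLike.re ⟪S (S x), S x⟫_𝕜 ≤ ‖S (S x)‖ * ‖S x‖ := re_inner_le_norm _ _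
      _ ≤ (t * ‖S x‖) * ‖S x‖ := by
        gcongr
        exact S.le_of_opNorm_le hSt _
      _ = t * ‖S x‖ ^ 2 := by ring
  simp only [map_sub, map_smul, inner_sub_left, inner_sub_right, inner_smul_left,
    inner_smul_right, RCLike.conj_ofReal, RCLike.re_ofReal_mul, h1, inner_self_eq_norm_sq] at h0
  have h3 : 0 ≤ t * (t * RCLike.re ⟪S x, x⟫_𝕜 - ‖S x‖ ^ 2) := by linarith
  linarith [nonneg_of_mul_nonneg_right h3 ht]

theorem ContinuousLinearMap.IsPositive.norm_smul_one_sub_lt {S : H →L[𝕜] H} (hS : S.IsPositive)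
    (hu : IsUnit S) {t : ℝ} (ht : 0 < t) (hSt : ‖S‖ ≤ t) :
    ‖(t : 𝕜) • (1 : H →L[𝕜] H) - S‖ < t := by
  obtain ⟨R, hR⟩ := hu.exists_left_inv
  set M := ‖R‖ + 1
  have hM : 0 < M := by positivity
  have hx (x : H) : ‖x‖ ≤ M * ‖S x‖ := by
    calc ‖x‖ = ‖R (S x)‖ := by rw [← mul_apply_eq_comp, hR]; rfl
      _ ≤ M * ‖S x‖ := R.le_of_opNorm_le (by simp [M]) _
  refine lt_of_le_of_lt (ContinuousLinearMap.opNorm_le_bound _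
    (Real.sqrt_nonneg (t ^ 2 - (M ^ 2)⁻¹)) fun x => ?_)
    ((Real.sqrt_lt' ht).2 (sub_lt_self _ (by positivity)))
  rw [← Real.sqrt_sq (norm_nonneg x), ← Real.sqrt_mul' _ (sq_nonneg ‖x‖)]
  apply Real.le_sqrt_of_sq_le
  have h1 : ‖x‖ ^ 2 * (M ^ 2)⁻¹ ≤ ‖S x‖ ^ 2 := by
    rw [← div_eq_mul_inv, div_le_iff₀ (by positivity), ← mul_pow, mul_comm]
    exact pow_le_pow_left₀ (norm_nonneg x) (hx x) 2
  have h2 := hS.norm_apply_sq_le_s19 ht hSt x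
  have h3 : ((t : 𝕜) • (1 : H →L[𝕜] H) - S) x = (t : 𝕜) • x - S x := rfl
  rw [h3, @norm_sub_sq 𝕜, inner_smul_left, RCLike.conj_ofReal, RCLike.re_ofReal_mul,
    inner_re_symm, norm_smul, RCLike.norm_ofReal, mul_pow, sq_abs]
  linarith

/-- Two positive invertible operators with the same square are equal. -/
theorem ContinuousLinearMap.IsPositive.eq_of_mul_self_eq {S T : H →L[𝕜] H}
    (hS : S.IsPositive) (hT : T.IsPositive) (huS : IsUnit S) (huT : IsUnit T)
    (h : S * S = T * T) : S = T := by
  set t := max ‖S‖ ‖T‖ + 1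
  have ht : 0 < t := by positivity
  have hSt := hS.norm_smul_one_sub_lt huS ht (by simp only [t]; linarith [le_max_left ‖S‖ ‖T‖])
  have hTt := hT.norm_smul_one_sub_lt huT ht (by simp only [t]; linarith [le_max_right ‖S‖ ‖T‖])
  have key : ((2 * t : ℝ) : 𝕜) • (S - T) =
      ((t : 𝕜) • 1 - S) * (S - T) + (S - T) * ((t : 𝕜) • 1 - T) := by
    have : (2 * t : ℝ) = t + t := by ring
    rw [this]
    simp only [RCLike.ofReal_add, add_smul, sub_mul, mul_sub, smul_mul_assoc, mul_smul_comm,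
      one_mul, mul_one, smul_sub, h]
    abel
  have hn := congrArg norm key
  rw [norm_smul, RCLike.norm_ofReal, abs_of_pos (by positivity)] at hn
  have h1 : 2 * t * ‖S - T‖ ≤
      ‖(t : 𝕜) • 1 - S‖ * ‖S - T‖ + ‖S - T‖ * ‖(t : 𝕜) • 1 - T‖ :=
    hn.trans_le ((norm_add_le _ _).trans (add_le_add (norm_mul_le _ _) (norm_mul_le _ _)))
  by_contra hne
  have hpos : 0 < ‖S - T‖ := norm_pos_iff.2 (sub_ne_zero.2 hne)
  nlinarith

/-- If `K` is self-adjoint with `‖K‖ < 1`, then `1 - X` is a square root of `1 - K`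
for some self-adjoint `X` with `‖X‖ < 1`. -/
theorem ContinuousLinearMap.exists_isSelfAdjoint_one_sub_mul_self [CompleteSpace H]
    {K : H →L[𝕜] H} (hK : IsSelfAdjoint K) (hK1 : ‖K‖ < 1) :
    ∃ X : H →L[𝕜] H, IsSelfAdjoint X ∧ ‖X‖ < 1 ∧ (1 - X) * (1 - X) = 1 - K := by
  let f : (H →L[𝕜] H) → (H →L[𝕜] H) := fun X => (2⁻¹ : 𝕜) • (K + X * X)
  let s : Set (H →L[𝕜] H) := {X | IsSelfAdjoint X} ∩ Metric.closedBall 0 ‖K‖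
  have h2 : ‖(2⁻¹ : 𝕜)‖ = 2⁻¹ := by simp
  have hsc : IsComplete s :=
    ((isClosed_eq continuous_star continuous_id).inter Metric.isClosed_closedBall).isComplete
  have hsf : Set.MapsTo f s s := by
    rintro X ⟨hX, hXn⟩
    rw [mem_closedBall_zero_iff] at hXn
    refine ⟨?_, ?_⟩
    · have hXX : IsSelfAdjoint (X * X) := hX.commute_iff hX |>.1 (Commute.refl X)
      exact (IsSelfAdjoint.smul (by simp [isSelfAdjoint_iff]) (hK.add hXX))
    · rw [mem_closedBall_zero_iff, norm_smul, h2]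
      have : ‖K + X * X‖ ≤ ‖K‖ + ‖X‖ * ‖X‖ :=
        (norm_add_le _ _).trans (by gcongr; exact norm_mul_le _ _)
      nlinarith [norm_nonneg X, norm_nonneg K]
  have hf : ContractingWith ‖K‖₊ (hsf.restrict f s s) := by
    refine ⟨by exact_mod_cast hK1, LipschitzWith.of_dist_le_mul ?_⟩
    rintro ⟨X, hX, hXn⟩ ⟨Y, hY, hYn⟩
    rw [mem_closedBall_zero_iff] at hXn hYn
    simp only [Subtype.dist_eq, Set.MapsTo.val_restrict_apply, dist_eq_norm, coe_nnnorm]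
    have : f X - f Y = (2⁻¹ : 𝕜) • (X * (X - Y) + (X - Y) * Y) := by
      simp only [f, ← smul_sub, mul_sub, sub_mul]
      congr 1
      abel
    rw [this, norm_smul, h2]
    have : ‖X * (X - Y) + (X - Y) * Y‖ ≤ ‖X‖ * ‖X - Y‖ + ‖X - Y‖ * ‖Y‖ :=
      (norm_add_le _ _).trans (add_le_add (norm_mul_le _ _) (norm_mul_le _ _))
    nlinarith [norm_nonneg (X - Y)]
  obtain ⟨X, ⟨hX, hXn⟩, hfix, -⟩ := hf.exists_fixedPoint' hsc hsf
    (x := 0) ⟨IsSelfAdjoint.zero _, by simp⟩ (edist_ne_top _ _)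
  rw [mem_closedBall_zero_iff] at hXn
  refine ⟨X, hX, hXn.trans_lt hK1, ?_⟩
  have h3 : (2 : 𝕜) • X = K + X * X := by
    have h4 : (2⁻¹ : 𝕜) • (K + X * X) = X := hfix
    conv_lhs => rw [← h4]
    rw [smul_smul, mul_inv_cancel₀ two_ne_zero, one_smul]
  have h5 : K = X + X - X * X := by
    rw [eq_sub_iff_add_eq, ← h3, two_smul]
  rw [h5]
  noncomm_ring

/-- A positive invertible operator has a positive invertible square root. -/
theorem ContinuousLinearMap.IsPositive.exists_isUnit_mul_self_eq [CompleteSpace H]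
    {B : H →L[𝕜] H} (hB : B.IsPositive) (hu : IsUnit B) :
    ∃ T : H →L[𝕜] H, T.IsPositive ∧ IsUnit T ∧ T * T = B := by
  set t := ‖B‖ + 1
  have ht : 0 < t := by positivity
  have ht' : (t : 𝕜) ≠ 0 := by exact_mod_cast ht.ne'
  have hlt := hB.norm_smul_one_sub_lt hu ht (by simp [t])
  have hsq : (((√t : ℝ) : 𝕜)) * ((√t : ℝ) : 𝕜) = (t : 𝕜) := by
    rw [← RCLike.ofReal_mul, Real.mul_self_sqrt ht.le]
  obtain ⟨X, hX, hX1, hXX⟩ := exists_isSelfAdjoint_one_sub_mul_self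
    (K := ((t⁻¹ : ℝ) : 𝕜) • ((t : 𝕜) • (1 : H →L[𝕜] H) - B))
    (IsSelfAdjoint.smul (by simp [isSelfAdjoint_iff])
      (IsSelfAdjoint.sub (IsSelfAdjoint.smul (by simp [isSelfAdjoint_iff]) (IsSelfAdjoint.one _))
        hB.isSelfAdjoint))
    (by
      rw [norm_smul, RCLike.norm_ofReal, abs_of_pos (by positivity), inv_mul_lt_iff₀ ht]
      simpa using hlt)
  have hpos : (1 - X).IsPositive := by
    rw [isPositive_def']
    refine ⟨(IsSelfAdjoint.one _).sub hX, fun x => ?_⟩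
    have h1 : (1 - X).reApplyInnerSelf x = ‖x‖ ^ 2 - RCLike.re ⟪X x, x⟫_𝕜 := by
      rw [reApplyInnerSelf_apply, sub_apply, one_apply_eq_self, inner_sub_left, map_sub,
        inner_self_eq_norm_sq]
    have h2 : RCLike.re ⟪X x, x⟫_𝕜 ≤ ‖x‖ ^ 2 :=
      calc RCLike.re ⟪X x, x⟫_𝕜 ≤ ‖X x‖ * ‖x‖ := re_inner_le_norm _ _
        _ ≤ (1 * ‖x‖) * ‖x‖ := by
          gcongr
          exact X.le_of_opNorm_le hX1.le _
        _ = ‖x‖ ^ 2 := by ring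
    rw [h1]
    linarith
  have hTT : (((√t : ℝ) : 𝕜) • (1 - X)) * (((√t : ℝ) : 𝕜) • (1 - X)) = B := by
    rw [smul_mul_smul_comm, hsq, hXX, smul_sub, smul_smul, RCLike.ofReal_inv,
      mul_inv_cancel₀ ht', one_smul, sub_sub_cancel]
  refine ⟨_, hpos.smul_of_nonneg (by exact_mod_cast Real.sqrt_nonneg t), ?_, hTT⟩
  exact ((Commute.refl _).isUnit_mul_iff.1 (hTT ▸ hu)).1

/-- Invertible operators `T` and `A` map the unit sphere onto the same set if and only if
`T T* = A A*`. -/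
theorem ContinuousLinearMap.image_sphere_eq_iff_mul_star_eq [CompleteSpace H]
    {T A : H →L[𝕜] H} (hT : IsUnit T) (hA : IsUnit A) :
    T '' Metric.sphere 0 1 = A '' Metric.sphere 0 1 ↔ T * star T = A * star A := by
  obtain ⟨a, rfl⟩ := hA
  obtain ⟨u, rfl⟩ := hT
  obtain ⟨w, rfl⟩ : ∃ w, u = a * w := ⟨a⁻¹ * u, by simp⟩
  have hwinv (x : H) : (w : H →L[𝕜] H) ((↑w⁻¹ : H →L[𝕜] H) x) = x := by
    rw [← mul_apply_eq_comp, w.mul_inv, one_apply_eq_self]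
  have hainj : Function.Injective (a : H →L[𝕜] H) :=
    Function.LeftInverse.injective (g := (↑a⁻¹ : H →L[𝕜] H)) fun x => by
      rw [← mul_apply_eq_comp, a.inv_mul, one_apply_eq_self]
  have himg : ((a * w : (H →L[𝕜] H)ˣ) : H →L[𝕜] H) '' Metric.sphere 0 1 =
      (a : H →L[𝕜] H) '' ((w : H →L[𝕜] H) '' Metric.sphere 0 1) := by
    rw [Set.image_image]; rfl
  have hmul : ((a * w : (H →L[𝕜] H)ˣ) : H →L[𝕜] H) *
      star ((a * w : (H →L[𝕜] H)ˣ) : H →L[𝕜] H) =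
        a * (w * star (w : H →L[𝕜] H)) * star (a : H →L[𝕜] H) := by
    simp [mul_assoc]
  have hmul' : ((a : H →L[𝕜] H) * (w * star (w : H →L[𝕜] H)) * star (a : H →L[𝕜] H) =
      a * star (a : H →L[𝕜] H)) ↔ (w : H →L[𝕜] H) * star (w : H →L[𝕜] H) = 1 := by
    rw [a.isUnit.star.mul_left_inj, a.isUnit.mul_eq_left]
  rw [himg, hainj.image_injective.eq_iff, hmul, hmul']
  have hcomm : (w : H →L[𝕜] H) * star (w : H →L[𝕜] H) = 1 ↔
      star (w : H →L[𝕜] H) * (w : H →L[𝕜] H) = 1 := by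
    constructor <;> intro h
    · rw [← Units.inv_eq_of_mul_eq_one_right h, w.inv_mul]
    · rw [← Units.inv_eq_of_mul_eq_one_left h, w.mul_inv]
  rw [hcomm]
  have hiso : star (w : H →L[𝕜] H) * (w : H →L[𝕜] H) = 1 ↔
      ∀ x, ‖(w : H →L[𝕜] H) x‖ = ‖x‖ := (norm_map_iff_adjoint_comp_self _).symm
  rw [hiso]
  constructor
  · intro h x
    rcases eq_or_ne x 0 with rfl | hx
    · simp
    have hx' : ‖x‖ ≠ 0 := norm_ne_zero_iff.2 hx
    have h1 : (w : H →L[𝕜] H) (((‖x‖⁻¹ : ℝ) : 𝕜) • x) ∈ Metric.sphere (0 : H) 1 := by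
      rw [← h]
      exact Set.mem_image_of_mem _ (by simp [norm_smul, hx'])
    rw [mem_sphere_zero_iff_norm, map_smul, norm_smul, RCLike.norm_ofReal,
      abs_of_nonneg (by positivity), inv_mul_eq_one₀ hx'] at h1
    exact h1.symm
  · intro h
    ext y
    simp only [Set.mem_image, mem_sphere_zero_iff_norm]
    constructor
    · rintro ⟨x, hx, rfl⟩
      rw [h, hx]
    · intro hy
      exact ⟨_, by rw [← h, hwinv, hy], hwinv y⟩

end PositiveSquareRoot


/-- For an invertible bounded operator `A` on a separable Hilbert space
there is a unique positive invertible operator `T` mapping the unit sphere onto `A`'s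
image of the unit sphere; namely `T = (AA*)^{1/2}`, i.e. `T² = A A*`. -/
theorem unique_positive_operator_with_same_ellipsoid
    {𝕜 H : Type*} [RCLike 𝕜] [NormedAddCommGroup H] [InnerProductSpace 𝕜 H]
    [CompleteSpace H] [TopologicalSpace.SeparableSpace H]
    (A : H →L[𝕜] H) (hA : IsUnit A) :
    (∃! T : H →L[𝕜] H, T.IsPositive ∧ IsUnit T ∧
      ⇑T '' Metric.sphere (0 : H) 1 = ⇑A '' Metric.sphere (0 : H) 1) ∧
    (∀ T : H →L[𝕜] H, T.IsPositive → IsUnit T →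
      ⇑T '' Metric.sphere (0 : H) 1 = ⇑A '' Metric.sphere (0 : H) 1 →
      T ∘L T = A ∘L (ContinuousLinearMap.adjoint A)) := by
  have key {T : H →L[𝕜] H} (hT : T.IsPositive) (hu : IsUnit T) :
      T '' Metric.sphere 0 1 = A '' Metric.sphere 0 1 ↔ T * T = A * star A := by
    rw [ContinuousLinearMap.image_sphere_eq_iff_mul_star_eq hu hA, hT.isSelfAdjoint.star_eq]
  refine ⟨?_, fun T hT hu h => (key hT hu).1 h⟩
  have hAA := ContinuousLinearMap.isPositive_self_comp_adjoint A
  obtain ⟨T, hT, hu, hTT⟩ := hAA.exists_isUnit_mul_self_eq (hA.mul hA.star)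
  refine ⟨T, ⟨hT, hu, (key hT hu).2 hTT⟩, ?_⟩
  rintro S ⟨hS, huS, hSA⟩
  exact hS.eq_of_mul_self_eq hT huS hu (((key hS huS).1 hSA).trans hTT.symm)
end
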